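/- Maximality at easiness level three: let N ≥ 4 be an integer, let p₁, p₂, p₃ be distinct partitions of [k], let α₁, α₂, α₃ ∈ ℂ, and suppose ξ = α₁ ξ_{p₁} + α₂ ξ_{p₂} + α₃ ξ_{p₃} is nonzero. Then ⟨NC, ξ⟩ = NC or ⟨NC, ξ⟩ = P (equality of families meaning equality of each subspace C(k',ℓ')). -/

import Mathlib

open scoped Classical

/-- The block relation of a finite partition of `Fin n` (partition of `[n]`):
`x ∼_p y` iff `x` and `y` lie in the same block of `p`. -/
def PartRel {n : ℕ} (p : Finpartition (Finset.univ : Finset (Fin n))) (x y : Fin n) : Prop :=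
  ∃ B ∈ p.parts, x ∈ B ∧ y ∈ B

/-- `κ` is a crossing of the relation `r`: `κ = {a,b,c,d}` with `a < b < c < d`,
`r a c`, `r b d`, and `¬ r a b`. -/
def IsCross {n : ℕ} (r : Fin n → Fin n → Prop) (κ : Finset (Fin n)) : Prop :=
  ∃ a b c d : Fin n, a < b ∧ b < c ∧ c < d ∧ κ = {a, b, c, d} ∧ r a c ∧ r b d ∧ ¬ r a b

/-- `cr p`: the set of crossings of the partition `p`. -/
def cr {n : ℕ} (p : Finpartition (Finset.univ : Finset (Fin n))) : Set (Finset (Fin n)) :=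
  {κ | IsCross (PartRel p) κ}


/-- `crossers p` (`χ(p)`): the union of all crossings of `p`. -/
def crossers {n : ℕ} (p : Finpartition (Finset.univ : Finset (Fin n))) : Set (Fin n) :=
  {x | ∃ κ ∈ cr p, x ∈ κ}

/-- The vector `ξ_p ∈ (ℂ^N)^{⊗k}`, identified with `(Fin k → Fin N) → ℂ`:
its coordinate at `i` is `1` if `i` is constant on every block of `p`, else `0`. -/
noncomputable def xi (N : ℕ) {k : ℕ} (p : Finpartition (Finset.univ : Finset (Fin k))) :
    (Fin k → Fin N) → ℂ :=
  fun i => if ∀ x y, PartRel p x y → i x = i y then 1 else 0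

/-- The span of the noncrossing-partition vectors `ξ_p`, `p ∈ NC(k)`. -/
noncomputable def ncSpan (N k : ℕ) : Submodule ℂ ((Fin k → Fin N) → ℂ) :=
  Submodule.span ℂ
    {v | ∃ p : Finpartition (Finset.univ : Finset (Fin k)), cr p = ∅ ∧ v = xi N p}

/-- The span of the crossing-partition vectors `ξ_p`, `p ∈ CR(k)`. -/
noncomputable def crSpan (N k : ℕ) : Submodule ℂ ((Fin k → Fin N) → ℂ) :=
  Submodule.span ℂ
    {v | ∃ p : Finpartition (Finset.univ : Finset (Fin k)), (cr p).Nonempty ∧ v = xi N p}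

/-- The span of all partition vectors `ξ_p`, `p ∈ P(k)`. -/
noncomputable def allSpan (N k : ℕ) : Submodule ℂ ((Fin k → Fin N) → ℂ) :=
  Submodule.span ℂ
    {v | ∃ p : Finpartition (Finset.univ : Finset (Fin k)), v = xi N p}

/-- Linear maps `(ℂ^N)^{⊗k} → (ℂ^N)^{⊗ℓ}`, as matrices with rows indexed by
lower index tuples and columns by upper index tuples. -/
abbrev Mat (N k ℓ : ℕ) := Matrix (Fin ℓ → Fin N) (Fin k → Fin N) ℂ

/-- The tensor product of two such linear maps. -/
def tensorMat {N k ℓ k' ℓ' : ℕ} (S : Mat N k ℓ) (T : Mat N k' ℓ') :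
    Mat N (k + k') (ℓ + ℓ') :=
  fun i j =>
    S (fun a => i (Fin.castAdd ℓ' a)) (fun b => j (Fin.castAdd k' b)) *
      T (fun a => i (Fin.natAdd ℓ a)) (fun b => j (Fin.natAdd k b))

/-- The cup: the map `(ℂ^N)^{⊗2} → ℂ` sending `e_i ⊗ e_j` to `δ_{ij}`. -/
def cupMat (N : ℕ) : Mat N 2 0 := fun _ j => if j 0 = j 1 then 1 else 0

/-- A Tannaka–Krein dual at parameter `N`: a family of subspaces
`C k ℓ ⊆ Hom((ℂ^N)^{⊗k}, (ℂ^N)^{⊗ℓ})` closed under tensor products, composition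
and adjoints, containing the identity of `ℂ^N` and the cup. -/
structure TKDual (N : ℕ) where
  C : ∀ k ℓ : ℕ, Submodule ℂ (Mat N k ℓ)
  tensor_mem : ∀ {k ℓ k' ℓ' : ℕ} {S : Mat N k ℓ} {T : Mat N k' ℓ'},
    S ∈ C k ℓ → T ∈ C k' ℓ' → tensorMat S T ∈ C (k + k') (ℓ + ℓ')
  comp_mem : ∀ {k ℓ r : ℕ} {S : Mat N ℓ r} {T : Mat N k ℓ},
    S ∈ C ℓ r → T ∈ C k ℓ → S * T ∈ C k r
  adj_mem : ∀ {k ℓ : ℕ} {T : Mat N k ℓ}, T ∈ C k ℓ → T.conjTranspose ∈ C ℓ k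
  id_mem : (1 : Matrix (Fin 1 → Fin N) (Fin 1 → Fin N) ℂ) ∈ C 1 1
  cup_mem : cupMat N ∈ C 2 0

/-- The involution of `Fin (k + ℓ)` fixing the first `k` (upper) points and
reversing the order of the last `ℓ` (lower) points. -/
def lowerRev (k ℓ : ℕ) : Fin (k + ℓ) → Fin (k + ℓ) :=
  Fin.append (fun a : Fin k => Fin.castAdd ℓ a) (fun a : Fin ℓ => Fin.natAdd k a.rev)

/-- A partition of `[k + ℓ]` (first `k` points upper, last `ℓ` points lower) is
noncrossing when the partition obtained by reversing the order of the lower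
points has no crossing. -/
def IsNCPart {k ℓ : ℕ} (p : Finpartition (Finset.univ : Finset (Fin (k + ℓ)))) : Prop :=
  ∀ κ, ¬ IsCross (fun x y => PartRel p (lowerRev k ℓ x) (lowerRev k ℓ y)) κ

/-- The linear map `T_p : (ℂ^N)^{⊗k} → (ℂ^N)^{⊗ℓ}` of a partition `p` of `[k + ℓ]`:
its entry at (lower tuple `i`, upper tuple `j`) is `1` if the labelling of the points
of `p` by `j` on the upper points and `i` on the lower points is constant on each
block of `p`, and `0` otherwise. -/
noncomputable def Tmat (N : ℕ) (k ℓ : ℕ)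
    (p : Finpartition (Finset.univ : Finset (Fin (k + ℓ)))) : Mat N k ℓ :=
  fun i j => if ∀ x y, PartRel p x y → Fin.append j i x = Fin.append j i y then 1 else 0

/-- The family `P(k,ℓ) = span{T_p : p a partition of [k+ℓ]}`. -/
noncomputable def Pfam (N k ℓ : ℕ) : Submodule ℂ (Mat N k ℓ) :=
  Submodule.span ℂ (Set.range (Tmat N k ℓ))

/-- The family `NC(k,ℓ) = span{T_p : p a noncrossing partition of [k+ℓ]}`. -/
noncomputable def NCfam (N k ℓ : ℕ) : Submodule ℂ (Mat N k ℓ) :=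
  Submodule.span ℂ {T | ∃ p, IsNCPart p ∧ T = Tmat N k ℓ p}

/-- A vector in `(ℂ^N)^{⊗k}` viewed as a linear map `(ℂ^N)^{⊗0} → (ℂ^N)^{⊗k}`. -/
def vecMat {N k : ℕ} (v : (Fin k → Fin N) → ℂ) : Mat N 0 k := fun i _ => v i

/-- `⟨NC, ξ⟩`: the smallest Tannaka–Krein dual containing all of `NC` together with
the vector `ξ ∈ (ℂ^N)^{⊗k}` (in degree `(0,k)`), i.e. the intersection of all such. -/
noncomputable def genNCxi (N : ℕ) {k : ℕ} (ξ : (Fin k → Fin N) → ℂ) (k' ℓ' : ℕ) :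
    Submodule ℂ (Mat N k' ℓ') :=
  ⨅ (C : TKDual N) (_ : ∀ a b, NCfam N a b ≤ C.C a b) (_ : vecMat ξ ∈ C.C 0 k),
    C.C k' ℓ'

namespace NCMax

/-- The equivalence relation of a partition. -/
def toSetoid {n : ℕ} (p : Finpartition (Finset.univ : Finset (Fin n))) : Setoid (Fin n) where
  r := PartRel p
  iseqv := by
    refine ⟨fun x => ?_, ?_, ?_⟩
    · exact ⟨p.part x, p.part_mem.2 (Finset.mem_univ x), p.mem_part (Finset.mem_univ x),
        p.mem_part (Finset.mem_univ x)⟩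
    · rintro x y ⟨B, hB, hx, hy⟩
      exact ⟨B, hB, hy, hx⟩
    · rintro x y z ⟨B, hB, hx, hy⟩ ⟨B', hB', hy', hz⟩
      have : B = B' := by
        rw [← p.part_eq_of_mem hB hy, ← p.part_eq_of_mem hB' hy']
      subst this
      exact ⟨B, hB, hx, hz⟩

lemma toSetoid_apply {n : ℕ} (p : Finpartition (Finset.univ : Finset (Fin n))) (x y : Fin n) :
    toSetoid p x y ↔ PartRel p x y := Iff.rfl

lemma exists_toSetoid_eq {n : ℕ} (r : Setoid (Fin n)) : ∃ p, toSetoid p = r := by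
  refine ⟨Finpartition.ofSetoid r, ?_⟩
  ext x y
  rw [toSetoid_apply, PartRel, ← Finpartition.mem_part_iff_exists,
    Finpartition.mem_part_ofSetoid_iff_rel]
  exact r.comm' 

/-- The indicator of the labellings that are constant on the classes of `r`. -/
noncomputable def ind {N : ℕ} {X : Type*} (r : Setoid X) (w : X → Fin N) : ℂ :=
  if r ≤ Setoid.ker w then 1 else 0

lemma xi_eq_ind {N k : ℕ} (p : Finpartition (Finset.univ : Finset (Fin k))) :
    xi N p = ind (toSetoid p) :=
  funext fun _ => if_congr Iff.rfl rfl rfl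

/-- The relation `r` has no crossing with respect to the order induced by `pos`. -/
def Planar {X : Type*} (pos : X → ℕ) (r : Setoid X) : Prop :=
  ∀ a b c d, pos a < pos b → pos b < pos c → pos c < pos d → r a c → r b d → r a b

/-- The position of a point in the boundary order used for matrices. -/
def mpos (k ℓ : ℕ) (x : Fin (k + ℓ)) : ℕ := (lowerRev k ℓ x).val

lemma mpos_castAdd {k ℓ : ℕ} (a : Fin k) : mpos k ℓ (Fin.castAdd ℓ a) = a := by
  simp [mpos, lowerRev]

lemma mpos_natAdd {k ℓ : ℕ} (a : Fin ℓ) :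
    mpos k ℓ (Fin.natAdd k a) = k + (ℓ - 1 - a) := by
  simp [mpos, lowerRev]; omega

lemma lowerRev_lowerRev {k ℓ : ℕ} (x : Fin (k + ℓ)) : lowerRev k ℓ (lowerRev k ℓ x) = x := by
  refine Fin.addCases (fun a => ?_) (fun a => ?_) x <;> simp [lowerRev]

lemma isNCPart_iff {k ℓ : ℕ} (p : Finpartition (Finset.univ : Finset (Fin (k + ℓ)))) :
    IsNCPart p ↔ Planar (mpos k ℓ) (toSetoid p) := by
  constructor
  · intro h a b c d hab hbc hcd hac hbd
    by_contra hn
    refine h _ ⟨lowerRev k ℓ a, lowerRev k ℓ b, lowerRev k ℓ c, lowerRev k ℓ d, hab, hbc, hcd,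
      rfl, ?_⟩
    simp only [lowerRev_lowerRev]
    exact ⟨hac, hbd, hn⟩
  · rintro h κ ⟨a, b, c, d, hab, hbc, hcd, -, hac, hbd, hn⟩
    refine hn (h _ _ _ _ ?_ ?_ ?_ hac hbd) <;> simpa [mpos, lowerRev_lowerRev]

/-- The matrix of an equivalence relation. -/
noncomputable def mat (N : ℕ) {k ℓ : ℕ} (r : Setoid (Fin (k + ℓ))) : Mat N k ℓ :=
  fun i j => ind r (Fin.append j i)

lemma Tmat_eq_mat {N k ℓ : ℕ} (p : Finpartition (Finset.univ : Finset (Fin (k + ℓ)))) :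
    Tmat N k ℓ p = mat N (toSetoid p) :=
  funext fun _ => funext fun _ => if_congr Iff.rfl rfl rfl

/-- The span of all partition matrices, or of the planar ones if `planar` holds. -/
noncomputable def fam (planar : Prop) (N k ℓ : ℕ) : Submodule ℂ (Mat N k ℓ) :=
  Submodule.span ℂ {T | ∃ r : Setoid (Fin (k + ℓ)), (planar → Planar (mpos k ℓ) r) ∧ T = mat N r}

lemma NCfam_eq_fam (N k ℓ : ℕ) : NCfam N k ℓ = fam True N k ℓ := by
  unfold NCfam fam
  congr 1
  ext T
  constructor
  · rintro ⟨p, hp, rfl⟩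
    exact ⟨toSetoid p, fun _ => (isNCPart_iff p).1 hp, Tmat_eq_mat p⟩
  · rintro ⟨r, hr, rfl⟩
    obtain ⟨p, rfl⟩ := exists_toSetoid_eq r
    exact ⟨p, (isNCPart_iff p).2 (hr trivial), (Tmat_eq_mat p).symm⟩

lemma Pfam_eq_fam (N k ℓ : ℕ) : Pfam N k ℓ = fam False N k ℓ := by
  unfold Pfam fam
  congr 1
  ext T
  constructor
  · rintro ⟨p, rfl⟩
    exact ⟨toSetoid p, False.elim, Tmat_eq_mat p⟩
  · rintro ⟨r, -, rfl⟩
    obtain ⟨p, rfl⟩ := exists_toSetoid_eq r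
    exact ⟨p, Tmat_eq_mat p⟩

lemma mat_mem_fam {planar : Prop} {N k ℓ : ℕ} {r : Setoid (Fin (k + ℓ))}
    (hr : planar → Planar (mpos k ℓ) r) : mat N r ∈ fam planar N k ℓ :=
  Submodule.subset_span ⟨r, hr, rfl⟩

/-! ### Planar matrices given by monotone labels -/

lemma planar_ker_append {k ℓ : ℕ} {f : Fin k → ℕ} {h : Fin ℓ → ℕ} (hf : Monotone f)
    (hh : Monotone h) : Planar (mpos k ℓ) (Setoid.ker (Fin.append f h)) := by
  have key : ∀ x y z : Fin (k + ℓ), mpos k ℓ x < mpos k ℓ y → mpos k ℓ y < mpos k ℓ z →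
      Fin.append f h x ≤ Fin.append f h y ∨ Fin.append f h z ≤ Fin.append f h y := by
    intro x y z
    refine Fin.addCases (fun y => ?_) (fun y => ?_) y
    · refine Fin.addCases (fun x => ?_) (fun x => ?_) x
      · simp only [mpos_castAdd, Fin.append_left]
        intro hxy _
        exact Or.inl (hf (by simpa using hxy.le))
      · simp only [mpos_castAdd, mpos_natAdd]; omega
    · refine Fin.addCases (fun z => ?_) (fun z => ?_) z
      · simp only [mpos_castAdd, mpos_natAdd]; omega
      · simp only [mpos_natAdd, Fin.append_right]
        intro _ hyz
        exact Or.inr (hh (by rw [Fin.le_def]; omega))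
  intro a b c d hab hbc hcd hac hbd
  rw [Setoid.ker_def] at *
  have h1 := key a b c hab hbc
  have h2 := key b c d hbc hcd
  omega

/-- The matrix that identifies points with equal labels. -/
noncomputable def lmat (N : ℕ) {k ℓ : ℕ} (f : Fin k → ℕ) (h : Fin ℓ → ℕ) : Mat N k ℓ :=
  mat N (Setoid.ker (Fin.append f h))

lemma lmat_mem_fam {planar : Prop} {N k ℓ : ℕ} {f : Fin k → ℕ} {h : Fin ℓ → ℕ} (hf : Monotone f)
    (hh : Monotone h) : lmat N f h ∈ fam planar N k ℓ :=
  mat_mem_fam fun _ => planar_ker_append hf hh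

lemma ker_append_le {N k ℓ : ℕ} {f : Fin k → ℕ} {h : Fin ℓ → ℕ} {j : Fin k → Fin N}
    {i : Fin ℓ → Fin N} : Setoid.ker (Fin.append f h) ≤ Setoid.ker (Fin.append j i) ↔
      (∀ a b, f a = f b → j a = j b) ∧ (∀ a b, f a = h b → j a = i b) ∧
        ∀ a b, h a = h b → i a = i b := by
  rw [Setoid.le_def]
  simp only [Setoid.ker_def]
  constructor
  · intro H
    refine ⟨fun a b hab => ?_, fun a b hab => ?_, fun a b hab => ?_⟩
    · simpa using @H (Fin.castAdd ℓ a) (Fin.castAdd ℓ b) (by simpa using hab)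
    · simpa using @H (Fin.castAdd ℓ a) (Fin.natAdd k b) (by simpa using hab)
    · simpa using @H (Fin.natAdd k a) (Fin.natAdd k b) (by simpa using hab)
  · rintro ⟨h1, h2, h3⟩ x y
    refine Fin.addCases (fun x => ?_) (fun x => ?_) x <;>
      refine Fin.addCases (fun y => ?_) (fun y => ?_) y <;>
      simp only [Fin.append_left, Fin.append_right]
    · exact h1 x y
    · exact h2 x y
    · exact fun e => (h2 y x e.symm).symm
    · exact h3 x y

lemma lmat_apply {N k ℓ : ℕ} {f : Fin k → ℕ} {h : Fin ℓ → ℕ} (i : Fin ℓ → Fin N)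
    (j : Fin k → Fin N) : lmat N f h i j =
      if (∀ a b, f a = f b → j a = j b) ∧ (∀ a b, f a = h b → j a = i b) ∧
        (∀ a b, h a = h b → i a = i b) then 1 else 0 := by
  simp only [lmat, mat, ind, ker_append_le]

/-! ### Counting compatible labellings -/

lemma exists_sum_ind_eq {N : ℕ} {A X : Type*} [Fintype X] (f : A → X) (R : Setoid X) :
    ∃ c : ℂ, ∀ w : A → Fin N, (∑ u : X → Fin N, if u ∘ f = w then ind R u else 0) =
      c * ind (R.comap f) w := by
  by_cases hex : ∃ w : A → Fin N, R.comap f ≤ Setoid.ker w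
  swap
  · refine ⟨0, fun w => ?_⟩
    rw [zero_mul]
    refine Finset.sum_eq_zero fun u _ => ?_
    split_ifs with h
    · rw [ind, if_neg]
      intro hu
      refine hex ⟨w, ?_⟩
      subst h
      exact fun {x y} hxy => hu hxy
    · rfl
  obtain ⟨w₀, hw₀⟩ := hex
  refine ⟨∑ u : X → Fin N, if u ∘ f = w₀ then ind R u else 0, fun w => ?_⟩
  rw [ind]
  split_ifs with hw
  swap
  · rw [mul_zero]
    refine Finset.sum_eq_zero fun u _ => ?_
    split_ifs with h
    · rw [ind, if_neg]
      intro hu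
      refine hw ?_
      subst h
      exact fun {x y} hxy => hu hxy
    · rfl
  rw [mul_one]
  have key : ∀ w w' : A → Fin N, R.comap f ≤ Setoid.ker w → R.comap f ≤ Setoid.ker w' →
      ∃ F : (X → Fin N) → (X → Fin N), (∀ u, u ∘ f = w → R ≤ Setoid.ker u →
        F u ∘ f = w' ∧ R ≤ Setoid.ker (F u)) ∧
        ∀ u x, (∃ a, R x (f a) ∧ F u x = w' a) ∨ ((¬ ∃ a, R x (f a)) ∧ F u x = u x) := by
    intro w w' hw hw'
    refine ⟨fun u x => if h : ∃ a, R x (f a) then w' h.choose else u x, ?_, ?_⟩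
    · intro u huf hu
      have hval : ∀ x a, R x (f a) →
          (if h : ∃ a, R x (f a) then w' h.choose else u x) = w' a := by
        intro x a hxa
        have h : ∃ a, R x (f a) := ⟨a, hxa⟩
        rw [dif_pos h]
        exact hw' (R.trans' (R.symm' h.choose_spec) hxa)
      refine ⟨funext fun a => hval _ a (R.refl' _), ?_⟩
      intro x y hxy
      rw [Setoid.ker_def]
      beta_reduce
      by_cases h : ∃ a, R y (f a)
      · obtain ⟨a, ha⟩ := h
        rw [hval y a ha, hval x a (R.trans' hxy ha)]
      · have h' : ¬ ∃ a, R x (f a) := fun ⟨a, ha⟩ => h ⟨a, R.trans' (R.symm' hxy) ha⟩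
        rw [dif_neg h, dif_neg h']
        exact hu hxy
    · intro u x
      by_cases h : ∃ a, R x (f a)
      · exact Or.inl ⟨h.choose, h.choose_spec, by simp only [dif_pos h]⟩
      · exact Or.inr ⟨h, by simp only [dif_neg h]⟩
  obtain ⟨F, hF, hF'⟩ := key w w₀ hw hw₀
  obtain ⟨G, hG, hG'⟩ := key w₀ w hw₀ hw
  have inv : ∀ (w w' : A → Fin N) (F G : (X → Fin N) → (X → Fin N)),
      (∀ u x, (∃ a, R x (f a) ∧ F u x = w' a) ∨ ((¬ ∃ a, R x (f a)) ∧ F u x = u x)) →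
      (∀ u x, (∃ a, R x (f a) ∧ G u x = w a) ∨ ((¬ ∃ a, R x (f a)) ∧ G u x = u x)) →
      ∀ u, u ∘ f = w → R ≤ Setoid.ker u → G (F u) = u := by
    intro w w' F G hF hG u huf hu
    funext x
    rcases hG (F u) x with ⟨a, ha, e⟩ | ⟨hn, e⟩
    · rw [e, ← huf]
      exact (hu ha).symm
    · rw [e]
      rcases hF u x with ⟨a, ha, -⟩ | ⟨-, e'⟩
      · exact absurd ⟨a, ha⟩ hn
      · exact e'
  simp only [ind, ← ite_and, Finset.sum_boole]
  congr 1
  refine Finset.card_bij' (fun u _ => F u) (fun u _ => G u) ?_ ?_ ?_ ?_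
  · intro u hu
    simp only [Finset.mem_filter, Finset.mem_univ, true_and] at hu ⊢
    exact hF u hu.1 hu.2
  · intro u hu
    simp only [Finset.mem_filter, Finset.mem_univ, true_and] at hu ⊢
    exact hG u hu.1 hu.2
  · intro u hu
    simp only [Finset.mem_filter, Finset.mem_univ, true_and] at hu
    exact inv w w₀ F G hF' hG' u hu.1 hu.2
  · intro u hu
    simp only [Finset.mem_filter, Finset.mem_univ, true_and] at hu
    exact inv w₀ w G F hG' hF' u hu.1 hu.2

/-! ### Joining a pair of points -/

/-- The smallest equivalence relation containing `r` in which `x` and `y` are related. -/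
def link {X : Type*} (r : Setoid X) (x y : X) : Setoid X where
  r a b := r a b ∨ (r a x ∧ r y b) ∨ (r a y ∧ r x b)
  iseqv := by
    refine ⟨fun a => Or.inl (r.refl' a), ?_, ?_⟩
    · rintro a b (h | ⟨h, h'⟩ | ⟨h, h'⟩)
      · exact Or.inl (r.symm' h)
      · exact Or.inr (Or.inr ⟨r.symm' h', r.symm' h⟩)
      · exact Or.inr (Or.inl ⟨r.symm' h', r.symm' h⟩)
    · rintro a b c (h | ⟨h, h'⟩ | ⟨h, h'⟩) (g | ⟨g, g'⟩ | ⟨g, g'⟩)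
      · exact Or.inl (r.trans' h g)
      · exact Or.inr (Or.inl ⟨r.trans' h g, g'⟩)
      · exact Or.inr (Or.inr ⟨r.trans' h g, g'⟩)
      · exact Or.inr (Or.inl ⟨h, r.trans' h' g⟩)
      · exact Or.inr (Or.inl ⟨h, g'⟩)
      · exact Or.inl (r.trans' h g')
      · exact Or.inr (Or.inr ⟨h, r.trans' h' g⟩)
      · exact Or.inl (r.trans' h g')
      · exact Or.inr (Or.inr ⟨h, g'⟩)

lemma link_le_iff {X : Type*} {r s : Setoid X} {x y : X} :
    link r x y ≤ s ↔ r ≤ s ∧ s x y := by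
  constructor
  · intro h
    exact ⟨fun {a b} hab => h (Or.inl hab), h (Or.inr (Or.inl ⟨r.refl' x, r.refl' y⟩))⟩
  · rintro ⟨h, hxy⟩ a b (g | ⟨g, g'⟩ | ⟨g, g'⟩)
    · exact h g
    · exact s.trans' (h g) (s.trans' hxy (h g'))
    · exact s.trans' (h g) (s.trans' (s.symm' hxy) (h g'))

/-- The relation `r` has no crossing on the set `S`. -/
def PlanarOn {X : Type*} (pos : X → ℕ) (S : Set X) (r : Setoid X) : Prop :=
  ∀ a ∈ S, ∀ b ∈ S, ∀ c ∈ S, ∀ d ∈ S, pos a < pos b → pos b < pos c → pos c < pos d →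
    r a c → r b d → r a b

lemma planarOn_link {X : Type*} {pos : X → ℕ} {S : Set X} {r : Setoid X} {x y : X}
    (hpos : ∀ a ∈ S, ∀ b ∈ S, pos a = pos b → a = b)
    (hr : PlanarOn pos S r) (hx : x ∈ S) (hy : y ∈ S) (hxy : pos x < pos y)
    (hadj : ∀ z ∈ S, pos z ≤ pos x ∨ pos y ≤ pos z) : PlanarOn pos S (link r x y) := by
  -- a chord `b d` that is not joined to the link does not cross it
  have cut : ∀ a ∈ S, ∀ b ∈ S, ∀ c ∈ S, ∀ d ∈ S, ∀ x ∈ S, ∀ y ∈ S,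
      ((pos a < pos b ∧ pos b < pos c ∧ pos c < pos d) ∨
        (pos b < pos a ∧ pos a < pos d ∧ pos d < pos c)) →
      (pos x < pos y ∧ ∀ z ∈ S, (pos z ≤ pos x ∨ pos y ≤ pos z)) ∨
        (pos y < pos x ∧ ∀ z ∈ S, (pos z ≤ pos y ∨ pos x ≤ pos z)) →
      r a x → r y c → r b d → r a b ∨ r x b ∨ r y b ∨ r c b := by
    intro a ha b hb c hc d hd x hx y hy hord hadj hax hyc hbd
    by_contra! hn
    obtain ⟨hab, hxb, hyb, hcb⟩ := hn
    have nxb : pos x ≠ pos b := fun e => hxb (hpos x hx b hb e ▸ r.refl' _)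
    have nxd : pos x ≠ pos d := fun e => hxb (hpos x hx d hd e ▸ r.symm' hbd)
    have nyb : pos y ≠ pos b := fun e => hyb (hpos y hy b hb e ▸ r.refl' _)
    have nyd : pos y ≠ pos d := fun e => hyb (hpos y hy d hd e ▸ r.symm' hbd)
    have adjb : (pos x < pos b ∧ pos y < pos b) ∨ (pos b < pos x ∧ pos b < pos y) := by
      rcases hadj with ⟨_, hadj⟩ | ⟨_, hadj⟩ <;> have := hadj b hb <;> have := hadj d hd <;>
        omega
    have adjd : (pos x < pos d ∧ pos y < pos d) ∨ (pos d < pos x ∧ pos d < pos y) := by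
      rcases hadj with ⟨_, hadj⟩ | ⟨_, hadj⟩ <;> have := hadj b hb <;> have := hadj d hd <;>
        omega
    have hdb := r.symm' hbd
    have hxa := r.symm' hax
    have hcy := r.symm' hyc
    rcases hord with ⟨h1, h2, h3⟩ | ⟨h1, h2, h3⟩
    · -- order `a b c d`
      by_cases hin : pos b < pos x ∧ pos x < pos d
      · exact hab (hr a ha b hb x hx d hd h1 hin.1 hin.2 hax hbd)
      · rcases lt_or_ge (pos y) (pos b) with hy' | hy'
        · exact hyb (hr y hy b hb c hc d hd hy' h2 h3 hyc hbd)
        · have hdy : pos d < pos y := by omega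
          exact hcb (r.symm' (hr b hb c hc d hd y hy h2 h3 hdy hbd hcy))
    · -- order `b a d c`
      by_cases hin : pos b < pos y ∧ pos y < pos d
      · exact hyb (r.symm' (hr b hb y hy d hd c hc hin.1 hin.2 h3 hbd hyc))
      · rcases lt_or_ge (pos x) (pos b) with hx' | hx'
        · exact hxb (hr x hx b hb a ha d hd hx' h1 h2 hxa hbd)
        · have hdx : pos d < pos x := by omega
          exact hab (r.symm' (hr b hb a ha d hd x hx h1 h2 hdx hbd hax))
  intro a ha b hb c hc d hd hab hbc hcd hac hbd
  have toLink : ∀ {u v}, r u v → link r x y u v := fun h => Or.inl h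
  by_contra hn
  have na : ∀ z, r a z → ¬ r z b := fun z h h' => hn (toLink (r.trans' h h'))
  have nl : ∀ {u v}, (u = x ∧ v = y) ∨ (u = y ∧ v = x) → r a u → ¬ r v b := by
    rintro u v (⟨rfl, rfl⟩ | ⟨rfl, rfl⟩) h h'
    · exact hn (Or.inr (Or.inl ⟨h, h'⟩))
    · exact hn (Or.inr (Or.inr ⟨h, h'⟩))
  have main : ∀ u ∈ S, ∀ v ∈ S, (u = x ∧ v = y) ∨ (u = y ∧ v = x) →
      r a u → r v c → ¬ r b d := by
    intro u hu v hv huv h h' hbd'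
    have hadj' : (pos u < pos v ∧ ∀ z ∈ S, (pos z ≤ pos u ∨ pos v ≤ pos z)) ∨
        (pos v < pos u ∧ ∀ z ∈ S, (pos z ≤ pos v ∨ pos u ≤ pos z)) := by
      rcases huv with ⟨rfl, rfl⟩ | ⟨rfl, rfl⟩
      · exact Or.inl ⟨hxy, hadj⟩
      · exact Or.inr ⟨hxy, hadj⟩
    rcases cut a ha b hb c hc d hd u hu v hv (Or.inl ⟨hab, hbc, hcd⟩) hadj' h h' hbd' with
      g | g | g | g
    · exact hn (toLink g)
    · exact na _ h g
    · exact nl huv h g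
    · exact nl huv h (r.trans' h' g)
  have main' : ∀ u ∈ S, ∀ v ∈ S, (u = x ∧ v = y) ∨ (u = y ∧ v = x) →
      r b u → r v d → ¬ r a c := by
    intro u hu v hv huv h h' hac'
    have hadj' : (pos u < pos v ∧ ∀ z ∈ S, (pos z ≤ pos u ∨ pos v ≤ pos z)) ∨
        (pos v < pos u ∧ ∀ z ∈ S, (pos z ≤ pos v ∨ pos u ≤ pos z)) := by
      rcases huv with ⟨rfl, rfl⟩ | ⟨rfl, rfl⟩
      · exact Or.inl ⟨hxy, hadj⟩
      · exact Or.inr ⟨hxy, hadj⟩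
    have huv' : (v = x ∧ u = y) ∨ (v = y ∧ u = x) := by tauto
    rcases cut b hb a ha d hd c hc u hu v hv (Or.inr ⟨hab, hbc, hcd⟩) hadj' h h' hac' with
      g | g | g | g
    · exact hn (toLink (r.symm' g))
    · exact na _ (r.symm' g) (r.symm' h)
    · exact nl huv' (r.symm' g) (r.symm' h)
    · exact nl huv' (r.symm' (r.trans' h' g)) (r.symm' h)
  rcases hac with hac | ⟨h, h'⟩ | ⟨h, h'⟩ <;> rcases hbd with hbd | ⟨g, g'⟩ | ⟨g, g'⟩
  · exact hn (toLink (hr a ha b hb c hc d hd hab hbc hcd hac hbd))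
  · exact main' x hx y hy (Or.inl ⟨rfl, rfl⟩) g g' hac
  · exact main' y hy x hx (Or.inr ⟨rfl, rfl⟩) g g' hac
  · exact main x hx y hy (Or.inl ⟨rfl, rfl⟩) h h' hbd
  · exact na _ h (r.symm' g)
  · exact nl (Or.inl ⟨rfl, rfl⟩) h (r.symm' g)
  · exact main y hy x hx (Or.inr ⟨rfl, rfl⟩) h h' hbd
  · exact nl (Or.inr ⟨rfl, rfl⟩) h (r.symm' g)
  · exact na _ h (r.symm' g)

/-- The disjoint union of two equivalence relations. -/
def sumSetoid {X Y : Type*} (r : Setoid X) (s : Setoid Y) : Setoid (X ⊕ Y) where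
  r := Sum.LiftRel r s
  iseqv := by
    refine ⟨?_, ?_, ?_⟩
    · rintro (x | y)
      · exact Sum.LiftRel.inl (r.refl' x)
      · exact Sum.LiftRel.inr (s.refl' y)
    · rintro _ _ (h | h)
      · exact Sum.LiftRel.inl (r.symm' h)
      · exact Sum.LiftRel.inr (s.symm' h)
    · rintro _ _ _ (h | h) (g | g)
      · exact Sum.LiftRel.inl (r.trans' h g)
      · exact Sum.LiftRel.inr (s.trans' h g)

@[simp] lemma sumSetoid_inl {X Y : Type*} {r : Setoid X} {s : Setoid Y} {a b : X} :
    sumSetoid r s (Sum.inl a) (Sum.inl b) ↔ r a b := Sum.liftRel_inl_inl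

@[simp] lemma sumSetoid_inr {X Y : Type*} {r : Setoid X} {s : Setoid Y} {a b : Y} :
    sumSetoid r s (Sum.inr a) (Sum.inr b) ↔ s a b := Sum.liftRel_inr_inr

@[simp] lemma sumSetoid_inl_inr {X Y : Type*} {r : Setoid X} {s : Setoid Y} {a : X} {b : Y} :
    ¬ sumSetoid r s (Sum.inl a) (Sum.inr b) := Sum.not_liftRel_inl_inr

@[simp] lemma sumSetoid_inr_inl {X Y : Type*} {r : Setoid X} {s : Setoid Y} {a : X} {b : Y} :
    ¬ sumSetoid r s (Sum.inr b) (Sum.inl a) := Sum.not_liftRel_inr_inl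

lemma sumSetoid_le_iff {X Y : Type*} {r : Setoid X} {s : Setoid Y} {t : Setoid (X ⊕ Y)} :
    sumSetoid r s ≤ t ↔ r ≤ t.comap Sum.inl ∧ s ≤ t.comap Sum.inr := by
  constructor
  · exact fun h => ⟨fun {a b} hab => h (Sum.LiftRel.inl hab),
      fun {a b} hab => h (Sum.LiftRel.inr hab)⟩
  · rintro ⟨h1, h2⟩ _ _ (h | h)
    · exact h1 h
    · exact h2 h

/-! ### The two families are Tannaka–Krein duals -/

lemma mpos_lt {k ℓ : ℕ} (x : Fin (k + ℓ)) : mpos k ℓ x < k + ℓ := (lowerRev k ℓ x).isLt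

lemma mpos_injective {k ℓ : ℕ} : Function.Injective (mpos k ℓ) := by
  intro x y h
  rw [← lowerRev_lowerRev x, ← lowerRev_lowerRev y, Fin.ext h]

lemma planar_comap {X Y : Type*} {pos : X → ℕ} {pos' : Y → ℕ} {R : Setoid Y} (f : X → Y)
    (S : Set Y) (hS : ∀ x, f x ∈ S) (hpos : ∀ a b, pos a < pos b → pos' (f a) < pos' (f b))
    (hR : PlanarOn pos' S R) : Planar pos (R.comap f) := fun a b c d hab hbc hcd hac hbd =>
  hR _ (hS a) _ (hS b) _ (hS c) _ (hS d) (hpos _ _ hab) (hpos _ _ hbc) (hpos _ _ hcd) hac hbd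

/-- Positions of the points of two matrices that are about to be composed. -/
def gpos (k ℓ m : ℕ) : Fin (k + ℓ) ⊕ Fin (ℓ + m) → ℕ :=
  Sum.elim (mpos k ℓ) (fun v => k + ℓ + mpos ℓ m v)

lemma gpos_injective {k ℓ m : ℕ} : Function.Injective (gpos k ℓ m) := by
  rintro (x | x) (y | y) h
  · exact congrArg _ (mpos_injective h)
  · have : mpos k ℓ x = k + ℓ + mpos ℓ m y := h
    have := mpos_lt x
    omega
  · have : k + ℓ + mpos ℓ m x = mpos k ℓ y := h
    have := mpos_lt y
    omega
  · exact congrArg _ (mpos_injective (Nat.add_left_cancel h))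

lemma planarOn_sumSetoid {k ℓ m : ℕ} {r : Setoid (Fin (k + ℓ))} {s : Setoid (Fin (ℓ + m))}
    (hr : Planar (mpos k ℓ) r) (hs : Planar (mpos ℓ m) s) (S : Set _) :
    PlanarOn (gpos k ℓ m) S (sumSetoid r s) := by
  rintro (a | a) - (b | b) - (c | c) - (d | d) - hab hbc hcd hac hbd <;>
    simp only [gpos, Sum.elim_inl, Sum.elim_inr, sumSetoid_inl, sumSetoid_inr, sumSetoid_inl_inr,
      sumSetoid_inr_inl] at *
  · exact hr a b c d hab hbc hcd hac hbd
  · have := mpos_lt c; omega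
  · have := mpos_lt b; omega
  · exact hs a b c d (by omega) (by omega) (by omega) hac hbd

lemma exists_glue {planar : Prop} {k ℓ m : ℕ} {r : Setoid (Fin (k + ℓ))}
    {s : Setoid (Fin (ℓ + m))} (hr : planar → Planar (mpos k ℓ) r)
    (hs : planar → Planar (mpos ℓ m) s) (j : ℕ) (hj : j ≤ ℓ) :
    ∃ R : Setoid (Fin (k + ℓ) ⊕ Fin (ℓ + m)),
      (planar → PlanarOn (gpos k ℓ m) {y | gpos k ℓ m y < k + ℓ - j ∨ k + ℓ + j ≤ gpos k ℓ m y} R) ∧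
      ∀ t : Setoid _, R ≤ t ↔ sumSetoid r s ≤ t ∧
        ∀ a : Fin ℓ, a.val < j → t (Sum.inl (Fin.natAdd k a)) (Sum.inr (Fin.castAdd m a)) := by
  induction j with
  | zero =>
    exact ⟨sumSetoid r s, fun hp => planarOn_sumSetoid (hr hp) (hs hp) _, fun t => by simp⟩
  | succ j ih =>
    obtain ⟨R, hR, ht⟩ := ih (by omega)
    have px : gpos k ℓ m (Sum.inl (Fin.natAdd k ⟨j, hj⟩)) = k + ℓ - (j + 1) :=
      (mpos_natAdd (k := k) (⟨j, hj⟩ : Fin ℓ)).trans (by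
        show k + (ℓ - 1 - j) = _
        omega)
    have py : gpos k ℓ m (Sum.inr (Fin.castAdd m ⟨j, hj⟩)) = k + ℓ + j := by
      show k + ℓ + mpos ℓ m (Fin.castAdd m ⟨j, hj⟩) = _
      rw [mpos_castAdd]
    refine ⟨link R (Sum.inl (Fin.natAdd k ⟨j, hj⟩)) (Sum.inr (Fin.castAdd m ⟨j, hj⟩)), ?_, ?_⟩
    · intro hp
      have := planarOn_link (x := Sum.inl (Fin.natAdd k ⟨j, hj⟩))
        (y := Sum.inr (Fin.castAdd m ⟨j, hj⟩)) (fun a _ b _ h => gpos_injective h) (hR hp)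
        (by rw [Set.mem_ofPred_eq, px]; omega) (by rw [Set.mem_ofPred_eq, py]; omega)
        (by rw [px, py]; omega)
        (by intro z hz; rw [Set.mem_ofPred_eq] at hz; rw [px, py]; omega)
      intro a ha b hb c hc d hd
      simp only [Set.mem_ofPred_eq] at ha hb hc hd
      exact this a (by rw [Set.mem_ofPred_eq]; omega) b (by rw [Set.mem_ofPred_eq]; omega)
        c (by rw [Set.mem_ofPred_eq]; omega) d (by rw [Set.mem_ofPred_eq]; omega)
    · intro t
      rw [link_le_iff, ht, and_assoc]
      refine and_congr_right fun _ => ⟨fun ⟨h1, h2⟩ a ha => ?_, fun h => ⟨fun a ha =>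
        h a (by omega), h _ (Nat.lt_succ_self j)⟩⟩
      rcases Nat.lt_succ_iff_lt_or_eq.1 ha with ha | ha
      · exact h1 a ha
      · have : a = ⟨j, hj⟩ := Fin.ext ha
        rw [this]; exact h2

lemma le_ker_comp {X Y Z : Type*} {r : Setoid X} (f : X → Y) (w : Y → Z) :
    r ≤ (Setoid.ker w).comap f ↔ r ≤ Setoid.ker (w ∘ f) := Iff.rfl

lemma mat_mul_mat {planar : Prop} {N k ℓ m : ℕ} {r : Setoid (Fin (k + ℓ))}
    {s : Setoid (Fin (ℓ + m))} (hr : planar → Planar (mpos k ℓ) r)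
    (hs : planar → Planar (mpos ℓ m) s) : mat N s * mat N r ∈ fam planar N k m := by
  obtain ⟨R, hR, ht⟩ := exists_glue hr hs ℓ le_rfl
  set o : Fin (k + m) → Fin (k + ℓ) ⊕ Fin (ℓ + m) :=
    Fin.append (fun a => Sum.inl (Fin.castAdd ℓ a)) (fun b => Sum.inr (Fin.natAdd ℓ b)) with ho
  obtain ⟨c, hc⟩ := exists_sum_ind_eq (N := N) o R
  have hker : ∀ u : Fin (k + ℓ) ⊕ Fin (ℓ + m) → Fin N, R ≤ Setoid.ker u ↔
      (r ≤ Setoid.ker (u ∘ Sum.inl) ∧ s ≤ Setoid.ker (u ∘ Sum.inr)) ∧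
        ∀ a : Fin ℓ, u (Sum.inl (Fin.natAdd k a)) = u (Sum.inr (Fin.castAdd m a)) := by
    intro u
    rw [ht, sumSetoid_le_iff, le_ker_comp, le_ker_comp]
    exact and_congr Iff.rfl ⟨fun h a => h a a.isLt, fun h a _ => h a⟩
  have : mat N s * mat N r = c • mat N (R.comap o) := by
    ext i j
    rw [Matrix.mul_apply, Matrix.smul_apply, smul_eq_mul, mat, ← hc]
    refine Finset.sum_of_injOn
      (fun mid => Sum.elim (Fin.append j mid) (Fin.append mid i)) ?_ ?_ ?_ ?_
    · intro mid _ mid' _ h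
      funext a
      simpa using congrFun h (Sum.inl (Fin.natAdd k a))
    · intro _ _; simp
    · intro u _ hu
      split_ifs with huo
      · rw [ind, if_neg]
        rintro hle
        refine hu ⟨fun a => u (Sum.inl (Fin.natAdd k a)), by simp, ?_⟩
        have h3 := ((hker u).1 hle).2
        funext y
        rcases y with y | y
        · refine Fin.addCases (fun a => ?_) (fun a => ?_) y
          · simpa [ho] using (congrFun huo (Fin.castAdd m a)).symm
          · simp
        · refine Fin.addCases (fun a => ?_) (fun a => ?_) y
          · simpa using h3 a
          · simpa [ho] using (congrFun huo (Fin.natAdd k a)).symm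
      · rfl
    · intro mid _
      rw [if_pos]
      · simp only [mat, ind, hker]
        simp only [Sum.elim_comp_inl, Sum.elim_comp_inr, Sum.elim_inl, Sum.elim_inr,
          Fin.append_left, Fin.append_right, implies_true, and_true, ite_and, mul_ite, mul_one,
          mul_zero]
      · funext y
        refine Fin.addCases (fun a => ?_) (fun a => ?_) y <;> simp [ho]
  rw [this]
  refine Submodule.smul_mem _ _ (mat_mem_fam fun hp => ?_)
  refine planar_comap o _ (fun x => ?_) (fun a b => ?_) (hR hp)
  · refine Fin.addCases (fun a => ?_) (fun a => ?_) x
    · simp only [ho, Fin.append_left, gpos, Set.mem_ofPred_eq, Sum.elim_inl, mpos_castAdd]; omega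
    · simp only [ho, Fin.append_right, gpos, Set.mem_ofPred_eq, Sum.elim_inr, mpos_natAdd]; omega
  · refine Fin.addCases (fun a => ?_) (fun a => ?_) a <;>
      refine Fin.addCases (fun b => ?_) (fun b => ?_) b <;>
      simp only [ho, Fin.append_left, Fin.append_right, gpos, Sum.elim_inl, Sum.elim_inr,
        mpos_castAdd, mpos_natAdd] <;> omega

lemma tensorMat_mat {planar : Prop} {N k ℓ k' ℓ' : ℕ} {r : Setoid (Fin (k + ℓ))}
    {s : Setoid (Fin (k' + ℓ'))} (hr : planar → Planar (mpos k ℓ) r)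
    (hs : planar → Planar (mpos k' ℓ') s) :
    tensorMat (mat N r) (mat N s) ∈ fam planar N (k + k') (ℓ + ℓ') := by
  set ψ : Fin (k + k' + (ℓ + ℓ')) → Fin (k + ℓ) ⊕ Fin (k' + ℓ') :=
    Fin.append (Fin.append (fun a => Sum.inl (Fin.castAdd ℓ a))
        (fun a => Sum.inr (Fin.castAdd ℓ' a)))
      (Fin.append (fun a => Sum.inl (Fin.natAdd k a)) (fun a => Sum.inr (Fin.natAdd k' a))) with hψ
  have hsurj : Function.Surjective ψ := by
    rintro (y | y)
    · refine Fin.addCases (fun a => ?_) (fun a => ?_) y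
      · exact ⟨Fin.castAdd _ (Fin.castAdd _ a), by simp [hψ]⟩
      · exact ⟨Fin.natAdd _ (Fin.castAdd _ a), by simp [hψ]⟩
    · refine Fin.addCases (fun a => ?_) (fun a => ?_) y
      · exact ⟨Fin.castAdd _ (Fin.natAdd _ a), by simp [hψ]⟩
      · exact ⟨Fin.natAdd _ (Fin.natAdd _ a), by simp [hψ]⟩
  have : tensorMat (mat N r) (mat N s) = mat N ((sumSetoid r s).comap ψ) := by
    ext i j
    set w : Fin (k + ℓ) ⊕ Fin (k' + ℓ') → Fin N :=
      Sum.elim (Fin.append (fun b => j (Fin.castAdd k' b)) (fun a => i (Fin.castAdd ℓ' a)))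
        (Fin.append (fun b => j (Fin.natAdd k b)) (fun a => i (Fin.natAdd ℓ a))) with hw
    have hwψ : Fin.append j i = w ∘ ψ := by
      funext y
      refine Fin.addCases (fun a => ?_) (fun a => ?_) y <;>
        refine Fin.addCases (fun a => ?_) (fun a => ?_) a <;> simp [hw, hψ]
    have hle : (sumSetoid r s).comap ψ ≤ Setoid.ker (Fin.append j i) ↔
        sumSetoid r s ≤ Setoid.ker w := by
      rw [hwψ]
      constructor
      · intro h x y
        obtain ⟨x, rfl⟩ := hsurj x
        obtain ⟨y, rfl⟩ := hsurj y
        exact fun hxy => h (x := x) (y := y) hxy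
      · intro h x y hxy
        exact h hxy
    simp only [tensorMat, mat, ind, hle, sumSetoid_le_iff, le_ker_comp]
    simp only [hw, Sum.elim_comp_inl, Sum.elim_comp_inr, ite_and, mul_ite, mul_one, mul_zero]
    split_ifs <;> rfl
  rw [this]
  refine mat_mem_fam fun hp => ?_
  have key : PlanarOn (Sum.elim (fun u => if mpos k ℓ u < k then mpos k ℓ u
      else mpos k ℓ u + (k' + ℓ')) (fun v => k + mpos k' ℓ' v)) Set.univ (sumSetoid r s) := by
    rintro (a | a) - (b | b) - (c | c) - (d | d) - hab hbc hcd hac hbd <;>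
      simp only [Sum.elim_inl, Sum.elim_inr, sumSetoid_inl, sumSetoid_inr, sumSetoid_inl_inr,
        sumSetoid_inr_inl] at *
    · exact hr hp a b c d (by split_ifs at * <;> omega) (by split_ifs at * <;> omega)
        (by split_ifs at * <;> omega) hac hbd
    · have := mpos_lt b; have := mpos_lt d; split_ifs at * <;> omega
    · have := mpos_lt a; have := mpos_lt c; split_ifs at * <;> omega
    · exact hs hp a b c d (by omega) (by omega) (by omega) hac hbd
  refine planar_comap ψ _ (fun x => Set.mem_univ _) (fun a b => ?_) key
  refine Fin.addCases (fun a => ?_) (fun a => ?_) a <;>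
    refine Fin.addCases (fun a => ?_) (fun a => ?_) a <;>
    refine Fin.addCases (fun b => ?_) (fun b => ?_) b <;>
    refine Fin.addCases (fun b => ?_) (fun b => ?_) b <;>
    simp only [hψ, Fin.append_left, Fin.append_right, Sum.elim_inl, Sum.elim_inr,
      mpos_castAdd, mpos_natAdd, Fin.val_castAdd, Fin.val_natAdd] <;>
      first | omega | (split_ifs <;> omega)

lemma conjTranspose_mat {planar : Prop} {N k ℓ : ℕ} {r : Setoid (Fin (k + ℓ))}
    (hr : planar → Planar (mpos k ℓ) r) : (mat N r).conjTranspose ∈ fam planar N ℓ k := by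
  set ψ : Fin (ℓ + k) → Fin (k + ℓ) := Fin.append (Fin.natAdd k) (Fin.castAdd ℓ) with hψ
  have hsurj : Function.Surjective ψ := by
    intro y
    refine Fin.addCases (fun a => ⟨Fin.natAdd _ a, by simp [hψ]⟩)
      (fun a => ⟨Fin.castAdd _ a, by simp [hψ]⟩) y
  have : (mat N r).conjTranspose = mat N (r.comap ψ) := by
    ext j i
    have hw : Fin.append i j = Fin.append j i ∘ ψ := by
      funext y
      refine Fin.addCases (fun a => ?_) (fun a => ?_) y <;> simp [hψ]
    have hle : r.comap ψ ≤ Setoid.ker (Fin.append i j) ↔ r ≤ Setoid.ker (Fin.append j i) := by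
      rw [hw]
      constructor
      · intro h x y
        obtain ⟨x, rfl⟩ := hsurj x
        obtain ⟨y, rfl⟩ := hsurj y
        exact fun hxy => h (x := x) (y := y) hxy
      · intro h x y hxy
        exact h hxy
    simp only [Matrix.conjTranspose_apply, mat, ind, hle]
    split_ifs <;> simp
  rw [this]
  refine mat_mem_fam fun hp a b c d hab hbc hcd hac hbd => ?_
  have hpos : ∀ x y, mpos ℓ k x < mpos ℓ k y → mpos k ℓ (ψ y) < mpos k ℓ (ψ x) := by
    intro x y
    refine Fin.addCases (fun a => ?_) (fun a => ?_) x <;>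
      refine Fin.addCases (fun b => ?_) (fun b => ?_) y <;>
      simp only [hψ, Fin.append_left, Fin.append_right, mpos_castAdd, mpos_natAdd] <;> omega
  have h := hr hp _ _ _ _ (hpos _ _ hcd) (hpos _ _ hbc) (hpos _ _ hab) (r.symm' hbd) (r.symm' hac)
  exact r.trans' hac (r.trans' (r.symm' h) (r.symm' hbd))

lemma one_eq_lmat (N k : ℕ) : (1 : Mat N k k) = lmat N Fin.val Fin.val := by
  ext i j
  rw [lmat_apply, Matrix.one_apply]
  refine if_congr ?_ rfl rfl
  constructor
  · rintro rfl
    refine ⟨fun a b h => ?_, fun a b h => ?_, fun a b h => ?_⟩ <;> rw [Fin.ext h]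
  · rintro ⟨-, h, -⟩
    exact funext fun a => (h a a rfl).symm

lemma cupMat_eq_lmat (N : ℕ) : cupMat N = lmat N (fun _ => 0) (fun _ => 0) := by
  ext i j
  rw [lmat_apply, cupMat]
  refine if_congr ?_ rfl rfl
  constructor
  · intro h
    refine ⟨fun a b _ => ?_, fun a b => b.elim0, fun a => a.elim0⟩
    fin_cases a <;> fin_cases b <;> simp [h]
  · rintro ⟨h, -, -⟩
    exact h 0 1 rfl

lemma tensorMat_add_left {N k ℓ k' ℓ' : ℕ} (S S' : Mat N k ℓ) (T : Mat N k' ℓ') :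
    tensorMat (S + S') T = tensorMat S T + tensorMat S' T := by
  ext i j; simp [tensorMat, add_mul]

lemma tensorMat_add_right {N k ℓ k' ℓ' : ℕ} (S : Mat N k ℓ) (T T' : Mat N k' ℓ') :
    tensorMat S (T + T') = tensorMat S T + tensorMat S T' := by
  ext i j; simp [tensorMat, mul_add]

lemma tensorMat_smul_left {N k ℓ k' ℓ' : ℕ} (c : ℂ) (S : Mat N k ℓ) (T : Mat N k' ℓ') :
    tensorMat (c • S) T = c • tensorMat S T := by
  ext i j; simp [tensorMat, mul_assoc]

lemma tensorMat_smul_right {N k ℓ k' ℓ' : ℕ} (c : ℂ) (S : Mat N k ℓ) (T : Mat N k' ℓ') :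
    tensorMat S (c • T) = c • tensorMat S T := by
  ext i j; simp [tensorMat, mul_left_comm]

/-- The Tannaka–Krein dual of all partitions, or of the noncrossing ones if `planar` holds. -/
noncomputable def famDual (planar : Prop) (N : ℕ) : TKDual N where
  C := fam planar N
  tensor_mem := by
    intro k ℓ k' ℓ' S T hS hT
    induction hS, hT using Submodule.span_induction₂ with
    | mem_mem S T hS hT =>
      obtain ⟨r, hr, rfl⟩ := hS
      obtain ⟨s, hs, rfl⟩ := hT
      exact tensorMat_mat hr hs
    | zero_left T hT =>
      convert Submodule.zero_mem _ using 1
      ext i j; simp [tensorMat]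
    | zero_right S hS =>
      convert Submodule.zero_mem _ using 1
      ext i j; simp [tensorMat]
    | add_left S S' T _ _ _ h h' => rw [tensorMat_add_left]; exact Submodule.add_mem _ h h'
    | add_right S T T' _ _ _ h h' => rw [tensorMat_add_right]; exact Submodule.add_mem _ h h'
    | smul_left c S T _ _ h => rw [tensorMat_smul_left]; exact Submodule.smul_mem _ _ h
    | smul_right c S T _ _ h => rw [tensorMat_smul_right]; exact Submodule.smul_mem _ _ h
  comp_mem := by
    intro k ℓ m S T hS hT
    induction hS, hT using Submodule.span_induction₂ with
    | mem_mem S T hS hT =>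
      obtain ⟨s, hs, rfl⟩ := hS
      obtain ⟨r, hr, rfl⟩ := hT
      exact mat_mul_mat hr hs
    | zero_left T hT => rw [Matrix.zero_mul]; exact Submodule.zero_mem _
    | zero_right S hS => rw [Matrix.mul_zero]; exact Submodule.zero_mem _
    | add_left S S' T _ _ _ h h' => rw [Matrix.add_mul]; exact Submodule.add_mem _ h h'
    | add_right S T T' _ _ _ h h' => rw [Matrix.mul_add]; exact Submodule.add_mem _ h h'
    | smul_left c S T _ _ h => rw [Matrix.smul_mul]; exact Submodule.smul_mem _ _ h
    | smul_right c S T _ _ h => rw [Matrix.mul_smul]; exact Submodule.smul_mem _ _ h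
  adj_mem := by
    intro k ℓ T hT
    induction hT using Submodule.span_induction with
    | mem T hT =>
      obtain ⟨r, hr, rfl⟩ := hT
      exact conjTranspose_mat hr
    | zero => rw [Matrix.conjTranspose_zero]; exact Submodule.zero_mem _
    | add S T _ _ h h' => rw [Matrix.conjTranspose_add]; exact Submodule.add_mem _ h h'
    | smul c T _ h => rw [Matrix.conjTranspose_smul]; exact Submodule.smul_mem _ _ h
  id_mem := by
    rw [one_eq_lmat]
    exact lmat_mem_fam (fun _ _ h => h) (fun _ _ h => h)
  cup_mem := by
    rw [cupMat_eq_lmat]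
    exact lmat_mem_fam monotone_const monotone_const

/-! ### The crossing vector generates all partitions -/

lemma one_mem (N k : ℕ) (C : TKDual N) (hC : ∀ a b, NCfam N a b ≤ C.C a b) :
    (1 : Mat N k k) ∈ C.C k k := by
  rw [one_eq_lmat]
  exact hC _ _ (NCfam_eq_fam N k k ▸ lmat_mem_fam (fun _ _ h => h) (fun _ _ h => h))

lemma lmat_mem {N k ℓ : ℕ} {C : TKDual N} (hC : ∀ a b, NCfam N a b ≤ C.C a b)
    {f : Fin k → ℕ} {h : Fin ℓ → ℕ} (hf : Monotone f) (hh : Monotone h) :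
    lmat N f h ∈ C.C k ℓ :=
  hC _ _ (NCfam_eq_fam N k ℓ ▸ lmat_mem_fam hf hh)

/-- The matrix permuting the tensor factors. -/
noncomputable def permMat (N : ℕ) {n : ℕ} (σ : Equiv.Perm (Fin n)) : Mat N n n :=
  fun i j => if i = j ∘ σ then 1 else 0

lemma mul_permMat {N k n : ℕ} (B : Mat N n k) (σ : Equiv.Perm (Fin n)) (i j) :
    (B * permMat N σ) i j = B i (j ∘ σ) := by
  rw [Matrix.mul_apply, Finset.sum_eq_single (j ∘ σ)]
  · simp [permMat]
  · intro m _ hm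
    simp [permMat, hm]
  · simp

lemma permMat_mul {N k n : ℕ} (B : Mat N k n) (σ : Equiv.Perm (Fin n)) (i j) :
    (permMat N σ⁻¹ * B) i j = B (i ∘ σ) j := by
  have key : ∀ m : Fin n → Fin N, i = m ∘ (σ⁻¹ : Equiv.Perm (Fin n)) ↔ m = i ∘ σ := by
    intro m
    constructor
    · rintro rfl; funext a; simp
    · rintro rfl; funext a; simp
  rw [Matrix.mul_apply, Finset.sum_eq_single (i ∘ σ)]
  · rw [permMat, if_pos ((key _).2 rfl), one_mul]
  · intro m _ hm
    rw [permMat, if_neg (fun h => hm ((key _).1 h)), zero_mul]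
  · simp

/-- The crossing on four points. -/
def cross : Setoid (Fin 4) := Setoid.ker ![0, 1, 0, 1]

lemma ind_cross {N : ℕ} (w : Fin 4 → Fin N) :
    ind cross w = if w 0 = w 2 ∧ w 1 = w 3 then 1 else 0 := by
  refine if_congr ?_ rfl rfl
  constructor
  · intro h
    exact ⟨@h 0 2 rfl, @h 1 3 rfl⟩
  · rintro ⟨h1, h2⟩ x y hxy
    rw [cross, Setoid.ker_def] at hxy
    rw [Setoid.ker_def]
    fin_cases x <;> fin_cases y <;> simp_all

lemma swap_mem {N : ℕ} {C : TKDual N} (hC : ∀ a b, NCfam N a b ≤ C.C a b)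
    (hX : vecMat (ind cross) ∈ C.C 0 4) : permMat N (Equiv.swap (0 : Fin 2) 1) ∈ C.C 2 2 := by
  have h1 : (tensorMat (1 : Mat N 2 2) (vecMat (ind cross)) : Mat N 2 6) ∈ C.C 2 6 :=
    C.tensor_mem (one_mem N 2 C hC) hX
  have h2 : lmat N ![0, 1, 1, 2, 3, 4] ![0, 2, 3, 4] ∈ C.C 6 4 :=
    lmat_mem hC (by decide) (by decide)
  have h3 : lmat N ![0, 0, 1, 2] ![1, 2] ∈ C.C 4 2 :=
    lmat_mem hC (by decide) (by decide)
  have e1 : ∀ (i : Fin 6 → Fin N) j,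
      (tensorMat (1 : Mat N 2 2) (vecMat (ind cross)) : Mat N 2 6) i j =
        if i 0 = j 0 ∧ i 1 = j 1 ∧ i 2 = i 4 ∧ i 3 = i 5 then 1 else 0 := by
    intro i j
    have : (tensorMat (1 : Mat N 2 2) (vecMat (ind cross)) : Mat N 2 6) i j =
        (if (fun a : Fin 2 => i (Fin.castAdd 4 a)) = j then 1 else 0) *
          ind cross (fun a => i (Fin.natAdd 2 a)) := by
      rw [tensorMat, Matrix.one_apply]; rfl
    rw [this, ind_cross, ite_zero_mul_ite_zero, mul_one]
    refine if_congr ?_ rfl rfl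
    rw [funext_iff, Fin.forall_fin_two, and_assoc]
    rfl
  have e2 : ∀ i j, lmat N ![0, 1, 1, 2, 3, 4] ![0, 2, 3, 4] i j =
      if j = ![i 0, j 1, j 1, i 1, i 2, i 3] then 1 else 0 := by
    intro i j
    rw [lmat_apply]
    refine if_congr ?_ rfl rfl
    simp only [funext_iff, Fin.forall_fin_succ, Fin.forall_fin_zero]
    simp
    tauto
  have e3 : ∀ i j, lmat N ![0, 0, 1, 2] ![1, 2] i j =
      if j = ![j 0, j 0, i 0, i 1] then 1 else 0 := by
    intro i j
    rw [lmat_apply]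
    refine if_congr ?_ rfl rfl
    simp only [funext_iff, Fin.forall_fin_succ, Fin.forall_fin_zero]
    simp
    tauto
  have e4 : ∀ i j, (lmat N ![0, 1, 1, 2, 3, 4] ![0, 2, 3, 4] *
      (tensorMat (1 : Mat N 2 2) (vecMat (ind cross)) : Mat N 2 6)) i j =
        if i 0 = j 0 ∧ i 2 = j 1 ∧ i 1 = i 3 then 1 else 0 := by
    intro i j
    rw [Matrix.mul_apply, Finset.sum_eq_single ![i 0, j 1, j 1, i 1, i 2, i 3]]
    · rw [e1, e2, if_pos (by simp), one_mul]
      refine if_congr ?_ rfl rfl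
      simp [eq_comm]
    · intro m _ hm
      rw [e1, e2]
      split_ifs with h h'
      · refine absurd (h.trans ?_) hm
        rw [h'.2.1]
      all_goals simp
    · simp
  have e5 : permMat N (Equiv.swap (0 : Fin 2) 1) = lmat N ![0, 0, 1, 2] ![1, 2] *
      (lmat N ![0, 1, 1, 2, 3, 4] ![0, 2, 3, 4] *
        (tensorMat (1 : Mat N 2 2) (vecMat (ind cross)) : Mat N 2 6)) := by
    ext i j
    rw [Matrix.mul_apply, Finset.sum_eq_single ![j 0, j 0, i 0, i 1]]
    · rw [e3, e4, if_pos (by simp), one_mul, permMat]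
      refine if_congr ?_ rfl rfl
      rw [funext_iff, Fin.forall_fin_two]
      simp [eq_comm]
    · intro m _ hm
      rw [e3, e4]
      split_ifs with h h'
      · refine absurd (h.trans ?_) hm
        rw [h'.1]
      all_goals simp
    · simp
  rw [e5]
  exact C.comp_mem h3 (C.comp_mem h2 h1)

lemma adjacent_swap_mem {N : ℕ} {C : TKDual N} (hC : ∀ a b, NCfam N a b ≤ C.C a b)
    (hX : vecMat (ind cross) ∈ C.C 0 4) {n : ℕ} (x y : Fin n) (hxy : y.val = x.val + 1) :
    permMat N (Equiv.swap x y) ∈ C.C n n := by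
  obtain ⟨a, ha⟩ : ∃ a, a = x.val := ⟨_, rfl⟩
  obtain ⟨b, rfl⟩ : ∃ b, n = a + (2 + b) := ⟨n - a - 2, by omega⟩
  obtain rfl : x = Fin.natAdd a (Fin.castAdd b 0) := Fin.ext (by simp [ha])
  obtain rfl : y = Fin.natAdd a (Fin.castAdd b 1) := Fin.ext (by simp [hxy])
  have : permMat N (Equiv.swap (Fin.natAdd a (Fin.castAdd b (0 : Fin 2)))
      (Fin.natAdd a (Fin.castAdd b 1))) = tensorMat (1 : Mat N a a)
        (tensorMat (permMat N (Equiv.swap (0 : Fin 2) 1)) (1 : Mat N b b)) := by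
    ext i j
    simp only [tensorMat, permMat, Matrix.one_apply]
    rw [ite_zero_mul_ite_zero, mul_one, ite_zero_mul_ite_zero, mul_one]
    refine if_congr ?_ rfl rfl
    simp only [funext_iff, Function.comp_apply]
    constructor
    · intro h
      refine ⟨fun z => ?_, fun z => ?_, fun z => ?_⟩
      · rw [h, Equiv.swap_apply_of_ne_of_ne]
        all_goals intro e; have := congrArg Fin.val e; simp at this; omega
      · rw [h]
        fin_cases z
        · exact congrArg j (Equiv.swap_apply_left _ _)
        · exact congrArg j (Equiv.swap_apply_right _ _)
      · rw [h, Equiv.swap_apply_of_ne_of_ne]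
        all_goals intro e; have := congrArg Fin.val e; simp at this <;> omega
    · rintro ⟨h1, h2, h3⟩ z
      refine Fin.addCases (fun z => ?_) (fun z => ?_) z
      · rw [h1, Equiv.swap_apply_of_ne_of_ne]
        all_goals intro e; have := congrArg Fin.val e; simp at this; omega
      · refine Fin.addCases (fun z => ?_) (fun z => ?_) z
        · rw [h2]
          fin_cases z
          · exact congrArg j (Equiv.swap_apply_left _ _).symm
          · exact congrArg j (Equiv.swap_apply_right _ _).symm
        · rw [h3, Equiv.swap_apply_of_ne_of_ne]
          all_goals intro e; have := congrArg Fin.val e; simp at this <;> omega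
  rw [this]
  exact C.tensor_mem (one_mem N a C hC) (C.tensor_mem (swap_mem hC hX) (one_mem N b C hC))

lemma permMat_mem {N : ℕ} {C : TKDual N} (hC : ∀ a b, NCfam N a b ≤ C.C a b)
    (hX : vecMat (ind cross) ∈ C.C 0 4) {n : ℕ} (σ : Equiv.Perm (Fin n)) :
    permMat N σ ∈ C.C n n := by
  have h1 : permMat N (1 : Equiv.Perm (Fin n)) ∈ C.C n n := one_mem N n C hC
  rcases n with _ | n
  · rwa [Subsingleton.elim σ 1]
  · have hσ : σ ∈ (⊤ : Submonoid (Equiv.Perm (Fin (n + 1)))) := trivial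
    rw [← Equiv.Perm.mclosure_swap_castSucc_succ] at hσ
    induction hσ using Submonoid.closure_induction with
    | mem τ hτ =>
      obtain ⟨i, rfl⟩ := hτ
      exact adjacent_swap_mem hC hX _ _ (by simp)
    | one => exact h1
    | mul σ τ _ _ h h' =>
      have : permMat N (σ * τ) = permMat N τ * permMat N σ := by
        ext i j
        rw [mul_permMat]
        rfl
      rw [this]
      exact C.comp_mem h' h

lemma exists_eq_ker {X : Type*} [Finite X] (r : Setoid X) : ∃ g : X → ℕ, r = Setoid.ker g := by
  obtain ⟨n, ⟨e⟩⟩ := Finite.exists_equiv_fin X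
  refine ⟨fun x => (e (Quotient.mk r x).out).val, ?_⟩
  ext x y
  rw [Setoid.ker_def, Fin.val_inj, e.apply_eq_iff_eq, Quotient.out_inj, Quotient.eq]

lemma Pfam_le_of_cross {N : ℕ} {C : TKDual N} (hC : ∀ a b, NCfam N a b ≤ C.C a b)
    (hX : vecMat (ind cross) ∈ C.C 0 4) (k ℓ : ℕ) : Pfam N k ℓ ≤ C.C k ℓ := by
  rw [Pfam_eq_fam, fam, Submodule.span_le]
  rintro _ ⟨r, -, rfl⟩
  obtain ⟨g, rfl⟩ := exists_eq_ker r
  set f : Fin k → ℕ := fun a => g (Fin.castAdd ℓ a) with hf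
  set h : Fin ℓ → ℕ := fun a => g (Fin.natAdd k a) with hh
  have hg : g = Fin.append f h := (Fin.append_castAdd_natAdd).symm
  have : mat N (Setoid.ker g) = permMat N (Tuple.sort h)⁻¹ *
      (lmat N (f ∘ Tuple.sort f) (h ∘ Tuple.sort h) * permMat N (Tuple.sort f)) := by
    ext i j
    rw [permMat_mul, mul_permMat, hg]
    change lmat N f h i j = _
    rw [lmat_apply, lmat_apply]
    refine if_congr (and_congr ?_ (and_congr ?_ ?_)) rfl rfl
    · rw [← (Tuple.sort f).forall_congr_right]
      exact forall_congr' fun a => (Tuple.sort f).forall_congr_right.symm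
    · rw [← (Tuple.sort f).forall_congr_right]
      exact forall_congr' fun a => (Tuple.sort h).forall_congr_right.symm
    · rw [← (Tuple.sort h).forall_congr_right]
      exact forall_congr' fun a => (Tuple.sort h).forall_congr_right.symm
  rw [SetLike.mem_coe, this]
  exact C.comp_mem (permMat_mem hC hX _) (C.comp_mem
    (lmat_mem hC (Tuple.monotone_sort f) (Tuple.monotone_sort h)) (permMat_mem hC hX _))

/-! ### Operations on the vectors of a Tannaka–Krein dual -/

/-- The vectors that belong to a Tannaka–Krein dual. -/
def vectors {N : ℕ} (C : TKDual N) (k : ℕ) : Submodule ℂ ((Fin k → Fin N) → ℂ) where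
  carrier := {v | vecMat v ∈ C.C 0 k}
  add_mem' h h' := (C.C 0 _).add_mem h h'
  zero_mem' := (C.C 0 _).zero_mem
  smul_mem' c _ h := (C.C 0 _).smul_mem c h

lemma mulVec_mem_vectors {N k m : ℕ} {C : TKDual N} {A : Mat N k m} (hA : A ∈ C.C k m)
    {v : (Fin k → Fin N) → ℂ} (hv : v ∈ vectors C k) : A.mulVec v ∈ vectors C m :=
  C.comp_mem hA hv

lemma vecMat_ind {N k : ℕ} (r : Setoid (Fin k)) :
    vecMat (ind r) = mat N (r.comap (Fin.cast (zero_add k))) := by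
  ext i j
  have hw : Fin.append j i = i ∘ Fin.cast (zero_add k) := by
    rw [Subsingleton.elim j Fin.elim0, Fin.elim0_append]
  rw [vecMat, mat, hw, ind, ind]
  refine if_congr ?_ rfl rfl
  exact ⟨fun h x y hxy => h hxy, fun h x y hxy =>
    @h (Fin.cast (zero_add k).symm x) (Fin.cast (zero_add k).symm y) hxy⟩

lemma vecMat_ind_mem_fam {planar : Prop} {N k : ℕ} {r : Setoid (Fin k)}
    (hr : planar → Planar Fin.val r) : vecMat (ind r) ∈ fam planar N 0 k := by
  rw [vecMat_ind]
  refine mat_mem_fam fun hp a b c d hab hbc hcd hac hbd => ?_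
  have hpos : ∀ x y : Fin (0 + k), mpos 0 k x < mpos 0 k y →
      (Fin.cast (zero_add k) y).val < (Fin.cast (zero_add k) x).val := by
    intro x y
    refine Fin.addCases (fun a => a.elim0) (fun a => ?_) x
    refine Fin.addCases (fun b => b.elim0) (fun b => ?_) y
    simp only [mpos_natAdd, Fin.val_cast, Fin.val_natAdd]
    omega
  have h := hr hp _ _ _ _ (hpos _ _ hcd) (hpos _ _ hbc) (hpos _ _ hab) (r.symm' hbd) (r.symm' hac)
  exact r.trans' hac (r.trans' (r.symm' h) (r.symm' hbd))

lemma ind_mem_vectors {N k : ℕ} {C : TKDual N} (hC : ∀ a b, NCfam N a b ≤ C.C a b)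
    {r : Setoid (Fin k)} (hr : Planar Fin.val r) : ind r ∈ vectors C k :=
  hC _ _ (NCfam_eq_fam N 0 k ▸ vecMat_ind_mem_fam fun _ => hr)

/-- The sum of the coordinates of the vector of `r`. -/
noncomputable def tot (N : ℕ) {k : ℕ} (r : Setoid (Fin k)) : ℂ := ∑ w : Fin k → Fin N, ind r w

lemma tot_ne_zero {N : ℕ} (hN : 0 < N) {k : ℕ} (r : Setoid (Fin k)) : tot N r ≠ 0 := by
  simp only [tot, ind, Finset.sum_boole]
  rw [Nat.cast_ne_zero, Finset.card_ne_zero]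
  exact ⟨fun _ => ⟨0, hN⟩, Finset.mem_filter.2 ⟨Finset.mem_univ _, fun _ _ _ => rfl⟩⟩

lemma tot_ker {N k m : ℕ} {f : Fin k → Fin m} (hf : Function.Surjective f) :
    tot N (Setoid.ker f) = (N : ℂ) ^ m := by
  simp only [tot, ind, Finset.sum_boole]
  have : (N : ℂ) ^ m = ((Finset.univ : Finset (Fin m → Fin N)).card : ℂ) := by
    simp
  rw [this]
  congr 1
  symm
  refine Finset.card_bij (fun u _ => u ∘ f) ?_ ?_ ?_
  · intro u _
    refine Finset.mem_filter.2 ⟨Finset.mem_univ _, fun x y h => ?_⟩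
    exact congrArg u h
  · intro u _ u' _ h
    exact hf.injective_comp_right h
  · intro w hw
    refine ⟨w ∘ Function.surjInv hf, Finset.mem_univ _, funext fun x => ?_⟩
    exact (Finset.mem_filter.1 hw).2 (Function.surjInv_eq hf (f x))

/-- The vector of `r`, scaled to coordinate sum `1`. -/
noncomputable def unitVec (N : ℕ) {k : ℕ} (r : Setoid (Fin k)) : (Fin k → Fin N) → ℂ :=
  (tot N r)⁻¹ • ind r

lemma unitVec_mem_vectors {N k : ℕ} {C : TKDual N} (hC : ∀ a b, NCfam N a b ≤ C.C a b)
    {r : Setoid (Fin k)} (hr : Planar Fin.val r) : unitVec N r ∈ vectors C k :=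
  Submodule.smul_mem _ _ (ind_mem_vectors hC hr)

/-- The matrix that sums out the points outside the image of `e`. -/
noncomputable def restrictMat (N : ℕ) {m k : ℕ} (e : Fin m → Fin k) : Mat N k m :=
  lmat N Fin.val (fun a => (e a).val)

lemma restrictMat_mulVec {N m k : ℕ} {e : Fin m → Fin k} (he : StrictMono e)
    (v : (Fin k → Fin N) → ℂ) (w : Fin m → Fin N) :
    (restrictMat N e).mulVec v w = ∑ u : Fin k → Fin N, if u ∘ e = w then v u else 0 := by
  rw [Matrix.mulVec, dotProduct]
  refine Finset.sum_congr rfl fun u _ => ?_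
  rw [restrictMat, lmat_apply, ite_mul, one_mul, zero_mul]
  refine if_congr ?_ rfl rfl
  constructor
  · rintro ⟨-, h, -⟩
    exact funext fun a => h _ a rfl
  · rintro rfl
    refine ⟨fun a b h => by rw [Fin.ext h], fun a b h => by rw [Fin.ext h]; rfl, fun a b h => ?_⟩
    rw [he.injective (Fin.ext h)]

lemma restrictMat_mem {N m k : ℕ} {C : TKDual N} (hC : ∀ a b, NCfam N a b ≤ C.C a b)
    {e : Fin m → Fin k} (he : StrictMono e) : restrictMat N e ∈ C.C k m :=
  lmat_mem hC (fun _ _ h => h) (fun _ _ h => he.monotone h)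

lemma restrictMat_unitVec {N m k : ℕ} (hN : 0 < N) {e : Fin m → Fin k} (he : StrictMono e)
    (r : Setoid (Fin k)) : (restrictMat N e).mulVec (unitVec N r) = unitVec N (r.comap e) := by
  obtain ⟨c, hc⟩ : ∃ c : ℂ, ∀ w : Fin m → Fin N, (∑ u : Fin k → Fin N,
      if u ∘ e = w then ind r u else 0) = c * ind (r.comap e) w := by
    obtain ⟨c, hc⟩ := exists_sum_ind_eq (N := N) e r
    exact ⟨c, fun w => by convert hc w⟩
  have h1 : (restrictMat N e).mulVec (ind r) = c • ind (r.comap e) := by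
    funext w
    rw [restrictMat_mulVec he, hc, Pi.smul_apply, smul_eq_mul]
  have h2 : tot N r = c * tot N (r.comap e) := by
    rw [tot, tot, Finset.mul_sum]
    simp only [← hc]
    rw [Finset.sum_comm]
    refine Finset.sum_congr rfl fun u _ => ?_
    rw [Finset.sum_ite_eq, if_pos (Finset.mem_univ _)]
  have hr := tot_ne_zero hN r
  have hr' := tot_ne_zero hN (r.comap e)
  have hc0 : c ≠ 0 := by
    rintro rfl
    exact hr (by rw [h2, zero_mul])
  rw [unitVec, Matrix.mulVec_smul, h1, h2, smul_smul, unitVec]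
  congr 1
  field_simp

/-- The equivalence relation generated by the image of `r` under `π`. -/
def push {X Y : Type*} (π : X → Y) (r : Setoid X) : Setoid Y := sInf {s | r ≤ s.comap π}

lemma le_comap_push {X Y : Type*} (π : X → Y) (r : Setoid X) : r ≤ (push π r).comap π := by
  intro a b hab
  exact Setoid.sInf_iff.2 fun s hs => hs hab

lemma push_le_iff {X Y : Type*} {π : X → Y} {r : Setoid X} {s : Setoid Y} :
    push π r ≤ s ↔ r ≤ s.comap π :=
  ⟨fun h => (le_comap_push π r).trans fun {_ _} hab => h hab, fun h => sInf_le h⟩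

/-- The matrix that identifies the points with equal images under `π`. -/
noncomputable def mergeMat (N : ℕ) {k m : ℕ} (π : Fin k → Fin m) : Mat N k m :=
  lmat N (fun a => (π a).val) Fin.val

lemma mergeMat_mulVec {N m k : ℕ} (π : Fin k → Fin m) (v : (Fin k → Fin N) → ℂ)
    (w : Fin m → Fin N) : (mergeMat N π).mulVec v w = v (w ∘ π) := by
  rw [Matrix.mulVec, dotProduct, Finset.sum_eq_single (w ∘ π)]
  · rw [mergeMat, lmat_apply, if_pos, one_mul]
    refine ⟨fun a b h => ?_, fun a b h => ?_, fun a b h => ?_⟩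
    · rw [Function.comp_apply, Fin.ext h]; rfl
    · rw [Function.comp_apply, Fin.ext h]
    · rw [Fin.ext h]
  · intro u _ hu
    rw [mergeMat, lmat_apply, if_neg, zero_mul]
    rintro ⟨-, h, -⟩
    exact hu (funext fun a => h a _ rfl)
  · simp

lemma mergeMat_mem {N m k : ℕ} {C : TKDual N} (hC : ∀ a b, NCfam N a b ≤ C.C a b)
    {π : Fin k → Fin m} (hπ : Monotone π) : mergeMat N π ∈ C.C k m :=
  lmat_mem hC (fun _ _ h => hπ h) (fun _ _ h => h)

lemma mergeMat_unitVec {N m k : ℕ} (hN : 0 < N) (π : Fin k → Fin m) (r : Setoid (Fin k)) :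
    (mergeMat N π).mulVec (unitVec N r) =
      (tot N (push π r) * (tot N r)⁻¹) • unitVec N (push π r) := by
  have h1 : (mergeMat N π).mulVec (ind r) = ind (push π r) := by
    funext w
    rw [mergeMat_mulVec, ind, ind]
    exact if_congr (push_le_iff (s := Setoid.ker w)).symm rfl rfl
  have := tot_ne_zero hN (push π r)
  rw [unitVec, Matrix.mulVec_smul, h1, unitVec, smul_smul]
  congr 1
  field_simp

/-! ### Short combinations of crossing partitions -/

noncomputable instance {n : ℕ} : Fintype (Setoid (Fin n)) :=
  haveI : Finite (Setoid (Fin n)) :=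
    Finite.of_injective (fun (r : Setoid (Fin n)) x y => r x y)
      fun _ _ h => Setoid.ext fun x y => iff_of_eq (congrFun (congrFun h x) y)
  Fintype.ofFinite _

/-- No nontrivial combination of at most three crossing partitions of `[n]` belongs to `C`. -/
def Rigid {N : ℕ} (C : TKDual N) (n : ℕ) : Prop :=
  ∀ g : Setoid (Fin n) → ℂ, (∀ r, Planar Fin.val r → g r = 0) →
    (Finset.univ.filter fun r => g r ≠ 0).card ≤ 3 →
    ∑ r, g r • unitVec N r ∈ vectors C n → ∀ r, g r = 0

lemma Rigid.eq_zero {N n : ℕ} {C : TKDual N} (hR : Rigid C n)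
    (hC : ∀ a b, NCfam N a b ≤ C.C a b) {G : Setoid (Fin n) → ℂ}
    (hcard : (Finset.univ.filter fun r => G r ≠ 0).card ≤ 3)
    (hG : ∑ r, G r • unitVec N r ∈ vectors C n) {s : Setoid (Fin n)}
    (hs : ¬ Planar Fin.val s) : G s = 0 := by
  have key := hR (fun s => if Planar Fin.val s then 0 else G s) (fun r hr => if_pos hr) ?_ ?_ s
  · simpa only [if_neg hs] using key
  · refine le_trans (Finset.card_le_card fun t ht => ?_) hcard
    have ht' := (Finset.mem_filter.1 ht).2
    rw [ite_ne_left_iff] at ht'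
    exact Finset.mem_filter.2 ⟨Finset.mem_univ _, ht'.2.symm⟩
  · have h2 : ∑ s, (if Planar Fin.val s then G s else 0) • unitVec N s ∈ vectors C n := by
      refine Submodule.sum_mem _ fun s _ => ?_
      split_ifs with h
      · exact Submodule.smul_mem _ _ (unitVec_mem_vectors hC h)
      · rw [zero_smul]; exact Submodule.zero_mem _
    convert Submodule.sub_mem _ hG h2 using 1
    rw [← Finset.sum_sub_distrib]
    refine Finset.sum_congr rfl fun s _ => ?_
    rw [← sub_smul]
    congr 1
    split_ifs <;> simp

lemma sum_fiber_eq_zero {N n m : ℕ} {C : TKDual N} (hC : ∀ a b, NCfam N a b ≤ C.C a b)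
    (hR : Rigid C m) {A : Mat N n m} (hA : A ∈ C.C n m) {φ : Setoid (Fin n) → Setoid (Fin m)}
    {c : Setoid (Fin n) → ℂ} (hφ : ∀ r, A.mulVec (unitVec N r) = c r • unitVec N (φ r))
    {g : Setoid (Fin n) → ℂ} (hcard : (Finset.univ.filter fun r => g r ≠ 0).card ≤ 3)
    (hg : ∑ r, g r • unitVec N r ∈ vectors C n) {s : Setoid (Fin m)}
    (hs : ¬ Planar Fin.val s) : ∑ r, (if φ r = s then c r * g r else 0) = 0 := by
  set G : Setoid (Fin m) → ℂ := fun s => ∑ r, if φ r = s then c r * g r else 0 with hG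
  have hsum : A.mulVec (∑ r, g r • unitVec N r) = ∑ s, G s • unitVec N s := by
    have : A.mulVec (∑ r, g r • unitVec N r) = ∑ r, g r • A.mulVec (unitVec N r) := by
      rw [← Matrix.mulVecLin_apply, map_sum]
      exact Finset.sum_congr rfl fun r _ => Matrix.mulVec_smul A (g r) (unitVec N r)
    rw [this]
    simp only [hG, Finset.sum_smul, hφ]
    rw [Finset.sum_comm]
    refine Finset.sum_congr rfl fun r _ => ?_
    simp only [ite_smul, zero_smul]
    rw [Finset.sum_ite_eq, if_pos (Finset.mem_univ _), smul_smul, mul_comm]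
  refine hR.eq_zero hC (le_trans (le_trans (Finset.card_le_card fun t ht => ?_)
    (Finset.card_image_le (f := φ))) hcard) (hsum ▸ mulVec_mem_vectors hA hg) hs
  obtain ⟨r, -, hr⟩ := Finset.exists_ne_zero_of_sum_ne_zero (Finset.mem_filter.1 ht).2
  rw [ite_ne_right_iff] at hr
  exact Finset.mem_image.2 ⟨r, Finset.mem_filter.2 ⟨Finset.mem_univ _,
    right_ne_zero_of_mul hr.2⟩, hr.1⟩

lemma exists_partner {N n m : ℕ} {C : TKDual N} (hC : ∀ a b, NCfam N a b ≤ C.C a b)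
    (hR : Rigid C m) {A : Mat N n m} (hA : A ∈ C.C n m) {φ : Setoid (Fin n) → Setoid (Fin m)}
    {c : Setoid (Fin n) → ℂ} (hφ : ∀ r, A.mulVec (unitVec N r) = c r • unitVec N (φ r))
    (hc : ∀ r, c r ≠ 0)
    {g : Setoid (Fin n) → ℂ} (hcard : (Finset.univ.filter fun r => g r ≠ 0).card ≤ 3)
    (hg : ∑ r, g r • unitVec N r ∈ vectors C n) {p : Setoid (Fin n)} (hp : g p ≠ 0)
    (hs : ¬ Planar Fin.val (φ p)) : ∃ q, g q ≠ 0 ∧ q ≠ p ∧ φ q = φ p := by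
  by_contra! hn
  have := sum_fiber_eq_zero hC hR hA hφ hcard hg hs
  rw [Finset.sum_eq_single p, if_pos rfl] at this
  · exact mul_ne_zero (hc p) hp this
  · intro q _ hq
    by_cases h0 : g q = 0
    · rw [h0, mul_zero, ite_self]
    · rw [if_neg (hn q h0 hq)]
  · simp

/-- A set of crossing partitions in which no member has a crossing image of its own under the
deletion of a point or the merging of two neighbours. -/
structure Paired {n : ℕ} (I : Finset (Setoid (Fin (n + 1)))) : Prop where
  not_planar : ∀ p ∈ I, ¬ Planar Fin.val p
  delete : ∀ p ∈ I, ∀ x : Fin (n + 1), ¬ Planar Fin.val (p.comap x.succAbove) →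
    ∃ q ∈ I, q ≠ p ∧ q.comap x.succAbove = p.comap x.succAbove
  merge : ∀ p ∈ I, ∀ x : Fin n, ¬ Planar Fin.val (push x.predAbove p) →
    ∃ q ∈ I, q ≠ p ∧ push x.predAbove q = push x.predAbove p

lemma paired_support {N n : ℕ} (hN : 0 < N) {C : TKDual N} (hC : ∀ a b, NCfam N a b ≤ C.C a b)
    (hR : Rigid C n) {g : Setoid (Fin (n + 1)) → ℂ} (hpl : ∀ r, Planar Fin.val r → g r = 0)
    (hcard : (Finset.univ.filter fun r => g r ≠ 0).card ≤ 3)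
    (hg : ∑ r, g r • unitVec N r ∈ vectors C (n + 1)) :
    Paired (Finset.univ.filter fun r => g r ≠ 0) where
  not_planar p hp h := (Finset.mem_filter.1 hp).2 (hpl p h)
  delete p hp x hx := by
    have he := Fin.strictMono_succAbove x
    obtain ⟨q, h1, h2, h3⟩ := exists_partner hC hR (restrictMat_mem hC he)
      (φ := fun r => r.comap x.succAbove) (c := fun _ => 1)
      (fun r => by rw [restrictMat_unitVec hN he, one_smul]) (fun _ => one_ne_zero) hcard hg
      (Finset.mem_filter.1 hp).2 hx
    exact ⟨q, Finset.mem_filter.2 ⟨Finset.mem_univ _, h1⟩, h2, h3⟩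
  merge p hp x hx := by
    obtain ⟨q, h1, h2, h3⟩ := exists_partner hC hR
      (mergeMat_mem hC (Fin.predAbove_right_monotone x)) (mergeMat_unitVec hN x.predAbove)
      (fun r => mul_ne_zero (tot_ne_zero hN _) (inv_ne_zero (tot_ne_zero hN _))) hcard hg
      (Finset.mem_filter.1 hp).2 hx
    exact ⟨q, Finset.mem_filter.2 ⟨Finset.mem_univ _, h1⟩, h2, h3⟩

/-! ### Three crossing partitions of at least six points are not paired -/

/-- `a < b < c < d` is a crossing of `r`. -/
structure Crossing {n : ℕ} (r : Setoid (Fin n)) (a b c d : Fin n) : Prop where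
  lt₁ : a < b
  lt₂ : b < c
  lt₃ : c < d
  rel₁ : r a c
  rel₂ : r b d
  not_rel : ¬ r a b

lemma not_planar_iff {n : ℕ} {r : Setoid (Fin n)} :
    ¬ Planar Fin.val r ↔ ∃ a b c d, Crossing r a b c d := by
  constructor
  · intro h
    unfold Planar at h
    push Not at h
    obtain ⟨a, b, c, d, h1, h2, h3, h4, h5, h6⟩ := h
    exact ⟨a, b, c, d, h1, h2, h3, h4, h5, h6⟩
  · rintro ⟨a, b, c, d, h⟩ hr
    exact h.not_rel (hr a b c d h.lt₁ h.lt₂ h.lt₃ h.rel₁ h.rel₂)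

/-- The points `x` and `y` are distinct and different from `a`, `b`, `c`, `d`. -/
structure Outside {n : ℕ} (a b c d x y : Fin n) : Prop where
  ne : x ≠ y
  left : x ≠ a ∧ x ≠ b ∧ x ≠ c ∧ x ≠ d
  right : y ≠ a ∧ y ≠ b ∧ y ≠ c ∧ y ≠ d

lemma Outside.symm {n : ℕ} {a b c d x y : Fin n} (h : Outside a b c d x y) :
    Outside a b c d y x := ⟨h.ne.symm, h.right, h.left⟩

lemma exists_outside {n : ℕ} (hn : 6 ≤ n) (a b c d : Fin n) : ∃ x y, Outside a b c d x y := by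
  have h : 1 < (({a, b, c, d} : Finset (Fin n))ᶜ).card := by
    rw [Finset.card_compl, Fintype.card_fin]
    have := Finset.card_le_four (a := a) (b := b) (c := c) (d := d)
    omega
  obtain ⟨x, hx, y, hy, hxy⟩ := Finset.one_lt_card.1 h
  exact ⟨x, y, hxy, by simpa using hx, by simpa using hy⟩

lemma exists_outside_ne {n : ℕ} (hn : 7 ≤ n) (a b c d : Fin n) :
    ∃ x y z, Outside a b c d x y ∧ z ≠ x ∧ z ≠ y ∧ z ≠ a ∧ z ≠ b ∧ z ≠ c ∧ z ≠ d := by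
  have h : 2 < (({a, b, c, d} : Finset (Fin n))ᶜ).card := by
    rw [Finset.card_compl, Fintype.card_fin]
    have := Finset.card_le_four (a := a) (b := b) (c := c) (d := d)
    omega
  obtain ⟨x, hx, y, hy, z, hz, hxy, hxz, hyz⟩ := Finset.two_lt_card.1 h
  exact ⟨x, y, z, ⟨hxy, by simpa using hx, by simpa using hy⟩, hxz.symm, hyz.symm,
    by simpa using hz⟩

lemma Outside.eq_or_eq {a b c d x y u : Fin 6} (h : Outside a b c d x y) (hab : a < b)
    (hbc : b < c) (hcd : c < d) (hu : u ≠ a ∧ u ≠ b ∧ u ≠ c ∧ u ≠ d) : u = x ∨ u = y := by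
  have hcard : ({x, y, a, b, c, d} : Finset (Fin 6)).card = 6 := by
    have := hab.trans hbc
    have := hbc.trans hcd
    have := hab.trans (hbc.trans hcd)
    obtain ⟨h1, h2, h3⟩ := h
    rw [Finset.card_insert_of_notMem, Finset.card_insert_of_notMem, Finset.card_insert_of_notMem,
      Finset.card_insert_of_notMem, Finset.card_pair] <;>
      simp [*, LT.lt.ne]
  have := Finset.eq_univ_of_card _ (hcard.trans (Fintype.card_fin 6).symm)
  have hmem := Finset.mem_univ u
  rw [← this] at hmem
  simpa [hu] using hmem

/-- The relations `p` and `q` agree on all pairs that avoid the point `x`. -/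
def AgreeOff {n : ℕ} (x : Fin n) (p q : Setoid (Fin n)) : Prop :=
  ∀ u v, u ≠ x → v ≠ x → (p u v ↔ q u v)

lemma AgreeOff.symm {n : ℕ} {x : Fin n} {p q : Setoid (Fin n)} (h : AgreeOff x p q) :
    AgreeOff x q p := fun u v hu hv => (h u v hu hv).symm

lemma AgreeOff.trans {n : ℕ} {x : Fin n} {p q r : Setoid (Fin n)} (h : AgreeOff x p q)
    (h' : AgreeOff x q r) : AgreeOff x p r := fun u v hu hv => (h u v hu hv).trans (h' u v hu hv)

lemma AgreeOff.crossing {n : ℕ} {x : Fin n} {p q : Setoid (Fin n)} (h : AgreeOff x p q)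
    {a b c d : Fin n} (hp : Crossing p a b c d) (hx : x ≠ a ∧ x ≠ b ∧ x ≠ c ∧ x ≠ d) :
    Crossing q a b c d where
  lt₁ := hp.lt₁
  lt₂ := hp.lt₂
  lt₃ := hp.lt₃
  rel₁ := (h _ _ hx.1.symm hx.2.2.1.symm).1 hp.rel₁
  rel₂ := (h _ _ hx.2.1.symm hx.2.2.2.symm).1 hp.rel₂
  not_rel := fun h' => hp.not_rel ((h _ _ hx.1.symm hx.2.1.symm).2 h')

lemma Crossing.not_planar_comap {n : ℕ} {p : Setoid (Fin (n + 1))} {a b c d x : Fin (n + 1)}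
    (hp : Crossing p a b c d) (hx : x ≠ a ∧ x ≠ b ∧ x ≠ c ∧ x ≠ d) :
    ¬ Planar Fin.val (p.comap x.succAbove) := by
  obtain ⟨a, rfl⟩ := Fin.exists_succAbove_eq hx.1.symm
  obtain ⟨b, rfl⟩ := Fin.exists_succAbove_eq hx.2.1.symm
  obtain ⟨c, rfl⟩ := Fin.exists_succAbove_eq hx.2.2.1.symm
  obtain ⟨d, rfl⟩ := Fin.exists_succAbove_eq hx.2.2.2.symm
  have hs := Fin.strictMono_succAbove x
  exact not_planar_iff.2 ⟨a, b, c, d, hs.lt_iff_lt.1 hp.lt₁, hs.lt_iff_lt.1 hp.lt₂,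
    hs.lt_iff_lt.1 hp.lt₃, hp.rel₁, hp.rel₂, hp.not_rel⟩

lemma agreeOff_of_comap_eq {n : ℕ} {x : Fin (n + 1)} {p q : Setoid (Fin (n + 1))}
    (h : p.comap x.succAbove = q.comap x.succAbove) : AgreeOff x p q := by
  intro u v hu hv
  obtain ⟨u, rfl⟩ := Fin.exists_succAbove_eq hu
  obtain ⟨v, rfl⟩ := Fin.exists_succAbove_eq hv
  exact Setoid.ext_iff.1 h u v

lemma eq_of_card_le_three {α : Type*} {I : Finset α} (hI : I.card ≤ 3) {a b c d : α}
    (ha : a ∈ I) (hb : b ∈ I) (hc : c ∈ I) (hd : d ∈ I) (hab : a ≠ b) (hac : a ≠ c)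
    (hbc : b ≠ c) : d = a ∨ d = b ∨ d = c := by
  have h : ({a, b, c} : Finset α) = I := by
    refine Finset.eq_of_subset_of_card_le ?_ ?_
    · intro z hz
      simp only [Finset.mem_insert, Finset.mem_singleton] at hz
      rcases hz with rfl | rfl | rfl <;> assumption
    · rwa [Finset.card_eq_three.2 ⟨a, b, c, hab, hac, hbc, rfl⟩]
  rw [← h] at hd
  simpa using hd

namespace Paired

lemma exists_agreeOff {n : ℕ} {I : Finset (Setoid (Fin (n + 1)))} (hI : Paired I)
    {p : Setoid (Fin (n + 1))} (hp : p ∈ I) {a b c d x : Fin (n + 1)} (hc : Crossing p a b c d)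
    (hx : x ≠ a ∧ x ≠ b ∧ x ≠ c ∧ x ≠ d) : ∃ q ∈ I, q ≠ p ∧ AgreeOff x p q := by
  obtain ⟨q, hq, hne, h⟩ := hI.delete p hp x (hc.not_planar_comap hx)
  exact ⟨q, hq, hne, agreeOff_of_comap_eq h.symm⟩

lemma agreeOff {n : ℕ} {I : Finset (Setoid (Fin (n + 1)))} (hI : Paired I) (hcard : I.card ≤ 3)
    {p q : Setoid (Fin (n + 1))} (hp : p ∈ I) (hq : q ∈ I) {a b c d x : Fin (n + 1)}
    (hpc : Crossing p a b c d) (hqc : Crossing q a b c d) (hx : x ≠ a ∧ x ≠ b ∧ x ≠ c ∧ x ≠ d) :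
    AgreeOff x p q := by
  by_contra hn
  obtain ⟨p', hp', hpp', hp''⟩ := hI.exists_agreeOff hp hpc hx
  obtain ⟨q', hq', hqq', hq''⟩ := hI.exists_agreeOff hq hqc hx
  have h1 : p ≠ q := by
    rintro rfl
    exact hn fun _ _ _ _ => Iff.rfl
  have h2 : q ≠ p' := by
    rintro rfl
    exact hn hp''
  rcases eq_of_card_le_three hcard hp hq hp' hq' h1 hpp'.symm h2 with rfl | rfl | rfl
  · exact hn hq''.symm
  · exact hqq' rfl
  · exact hn (hp''.trans hq''.symm)

lemma exists_toggle {n : ℕ} {I : Finset (Setoid (Fin (n + 1)))} (hI : Paired I)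
    (hcard : I.card ≤ 3) {p : Setoid (Fin (n + 1))} (hp : p ∈ I) {a b c d x y : Fin (n + 1)}
    (hc : Crossing p a b c d) (hxy : Outside a b c d x y) :
    ∃ q ∈ I, q ≠ p ∧ Crossing q a b c d ∧ AgreeOff x p q ∧ AgreeOff y p q := by
  obtain ⟨q, hq, hne, h⟩ := hI.exists_agreeOff hp hc hxy.left
  have hqc := h.crossing hc hxy.left
  exact ⟨q, hq, hne, hqc, h, hI.agreeOff hcard hp hq hc hqc hxy.right⟩

end Paired

lemma eq_of_agreeOff {n : ℕ} {x y : Fin n} {p q : Setoid (Fin n)} (hne : x ≠ y)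
    (hx : AgreeOff x p q)
    (hy : AgreeOff y p q) (hxy : p x y ↔ q x y) : p = q := by
  ext u v
  by_cases hu : u = v
  · subst hu
    exact iff_of_true (p.refl' _) (q.refl' _)
  by_cases h1 : u ≠ x ∧ v ≠ x
  · exact hx u v h1.1 h1.2
  by_cases h2 : u ≠ y ∧ v ≠ y
  · exact hy u v h2.1 h2.2
  have : (u = x ∧ v = y) ∨ (u = y ∧ v = x) := by grind
  rcases this with ⟨rfl, rfl⟩ | ⟨rfl, rfl⟩
  · exact hxy
  · rwa [p.comm', q.comm']

lemma push_eq_comap {X Y : Type*} {π : X → Y} {σ : Y → X} {x : X} {q : Setoid X}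
    (hπσ : ∀ s, π (σ s) = s) (hσπ : ∀ u, u ≠ x → σ (π u) = u) (hx : ∀ u, q x u → u = x) :
    push π q = q.comap σ := by
  refine le_antisymm (push_le_iff.2 ?_) ?_
  · intro u v huv
    change q (σ (π u)) (σ (π v))
    by_cases hu : u = x
    · subst hu
      rw [hx v huv]
    · have hv : v ≠ x := by
        rintro rfl
        exact hu (hx u (q.symm' huv))
      rwa [hσπ u hu, hσπ v hv]
  · intro s t hst
    simpa only [Setoid.comap_rel, hπσ] using le_comap_push π q hst

lemma Paired.false_of_adjacent {I : Finset (Setoid (Fin 6))} (hI : Paired I)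
    (hcard : I.card ≤ 3) {p q : Setoid (Fin 6)} (hp : p ∈ I) (hq : q ∈ I) {a b c d x y : Fin 6}
    (hqc : Crossing q a b c d) (hxy : Outside a b c d x y)
    (hx : AgreeOff x p q) (hy : AgreeOff y p q) (hpxy : p x y) (hqxy : ¬ q x y) {z : Fin 6}
    {m : Fin 5} (hzx : z ≠ x) (hzy : z ≠ y) (hmz : m.predAbove x = m.predAbove z)
    (hm : ∀ s, m.predAbove (x.succAbove s) = s) (hm' : ∀ u ≠ x, x.succAbove (m.predAbove u) = u) :
    False := by
  have hne := hxy.ne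
  have hxs : ∀ u, q x u → u = x := by
    intro u hu
    by_contra hux
    have huy : u ≠ y := by rintro rfl; exact hqxy hu
    have h1 : p x u := (hy x u hne huy).2 hu
    have h2 : q y u := (hx y u hne.symm hux).1 (p.trans' (p.symm' hpxy) h1)
    exact hqxy (q.trans' hu (q.symm' h2))
  have hys : ∀ u, q y u → u = y := by
    intro u hu
    by_contra huy
    have hux : u ≠ x := by rintro rfl; exact hqxy (q.symm' hu)
    have h1 : p y u := (hx y u hne.symm hux).2 hu
    have h2 : q x u := (hy x u hne huy).1 (p.trans' hpxy h1)
    exact hqxy (q.trans' h2 (q.symm' hu))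
  have hpush := push_eq_comap hm hm' hxs
  obtain ⟨r, hr, hrq, hrpush⟩ := hI.merge q hq m (hpush ▸ hqc.not_planar_comap hxy.left)
  have hrxy : ¬ r x y := by
    intro h
    have h1 := le_comap_push m.predAbove r (r.symm' h)
    rw [hrpush, hpush, Setoid.comap_rel, Setoid.comap_rel, hmz, hm' y hne.symm, hm' z hzx] at h1
    exact hzy (hys z h1)
  have hpq : p ≠ q := by rintro rfl; exact hqxy hpxy
  have hpr : p ≠ r := by rintro rfl; exact hrxy hpxy
  obtain ⟨a', b', c', d', hrc⟩ := not_planar_iff.1 (hI.not_planar r hr)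
  obtain ⟨x', y', hxy'⟩ := exists_outside le_rfl a' b' c' d'
  obtain ⟨r', hr', hne', hrc', hx', hy'⟩ := hI.exists_toggle hcard hr hrc hxy'
  rcases eq_of_card_le_three hcard hp hq hr hr' hpq hpr hrq.symm with rfl | rfl | rfl
  · have h1 : x = x' ∨ y = x' := by
      by_contra! h
      exact hrxy ((hx' x y h.1 h.2).2 hpxy)
    have h2 : x = y' ∨ y = y' := by
      by_contra! h
      exact hrxy ((hy' x y h.1 h.2).2 hpxy)
    have h3 : (x = x' ∧ y = y') ∨ (x = y' ∧ y = x') := by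
      have := hxy'.ne
      grind
    rcases h3 with ⟨rfl, rfl⟩ | ⟨rfl, rfl⟩
    · exact hrq (eq_of_agreeOff hne (hx'.trans hx) (hy'.trans hy) (iff_of_false hrxy hqxy))
    · exact hrq (eq_of_agreeOff hne (hy'.trans hx) (hx'.trans hy) (iff_of_false hrxy hqxy))
  · have hsing : ∀ w, (∀ u, r' w u → u = w) → w ≠ a' ∧ w ≠ b' ∧ w ≠ c' ∧ w ≠ d' := by
      intro w hw
      have h13 := hrc'.lt₁.trans hrc'.lt₂
      have h24 := hrc'.lt₂.trans hrc'.lt₃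
      refine ⟨?_, ?_, ?_, ?_⟩ <;> rintro rfl
      · exact h13.ne' (hw _ hrc'.rel₁)
      · exact h24.ne' (hw _ hrc'.rel₂)
      · exact h13.ne (hw _ (r'.symm' hrc'.rel₁))
      · exact h24.ne (hw _ (r'.symm' hrc'.rel₂))
    have h1 := hxy'.eq_or_eq hrc.lt₁ hrc.lt₂ hrc.lt₃ (hsing x hxs)
    have h2 := hxy'.eq_or_eq hrc.lt₁ hrc.lt₂ hrc.lt₃ (hsing y hys)
    rcases h1 with rfl | rfl <;> rcases h2 with rfl | rfl
    · exact hne rfl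
    · exact hrq (eq_of_agreeOff hne hx' hy' (iff_of_false hrxy hqxy))
    · exact hrq (eq_of_agreeOff hne hy' hx' (iff_of_false hrxy hqxy))
    · exact hne rfl
  · exact hne' rfl

lemma Paired.eq_empty {n : ℕ} (hn : 5 ≤ n) {I : Finset (Setoid (Fin (n + 1)))} (hI : Paired I)
    (hcard : I.card ≤ 3) : I = ∅ := by
  rw [Finset.eq_empty_iff_forall_notMem]
  intro p hp
  obtain ⟨a, b, c, d, hpc⟩ := not_planar_iff.1 (hI.not_planar p hp)
  rcases hn.lt_or_eq with hn | rfl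
  · obtain ⟨x, y, z, hxy, hzx, hzy, hz⟩ := exists_outside_ne (by omega) a b c d
    obtain ⟨q, hq, hne, hqc, hx, hy⟩ := hI.exists_toggle hcard hp hpc hxy
    exact hne (eq_of_agreeOff hxy.ne hx hy
      (hI.agreeOff hcard hp hq hpc hqc hz x y hzx.symm hzy.symm)).symm
  · obtain ⟨x, y, hxy⟩ := exists_outside le_rfl a b c d
    have key : ∀ p ∈ I, ∀ q ∈ I, Crossing p a b c d → Crossing q a b c d → AgreeOff x p q →
        AgreeOff y p q → p x y → q x y := by
      intro p hp q hq hpc hqc hx hy hpxy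
      by_contra hqxy
      have hadj : ∀ x y : Fin 6, x ≠ y → ∃ (m : Fin 5) (z : Fin 6),
          z ≠ x ∧ z ≠ y ∧ ((m.predAbove x = m.predAbove z ∧
            (∀ s, m.predAbove (x.succAbove s) = s) ∧ ∀ u ≠ x, x.succAbove (m.predAbove u) = u) ∨
          (m.predAbove y = m.predAbove z ∧
            (∀ s, m.predAbove (y.succAbove s) = s) ∧
              ∀ u ≠ y, y.succAbove (m.predAbove u) = u)) := by decide
      obtain ⟨m, z, hzx, hzy, ⟨h1, h2, h3⟩ | ⟨h1, h2, h3⟩⟩ := hadj x y hxy.ne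
      · exact hI.false_of_adjacent hcard hp hq hqc hxy hx hy hpxy hqxy hzx hzy h1 h2 h3
      · exact hI.false_of_adjacent hcard hp hq hqc hxy.symm hy hx (p.symm' hpxy)
          (fun h => hqxy (q.symm' h)) hzy hzx h1 h2 h3
    obtain ⟨q, hq, hne, hqc, hx, hy⟩ := hI.exists_toggle hcard hp hpc hxy
    exact hne (eq_of_agreeOff hxy.ne hx hy ⟨key p hp q hq hpc hqc hx hy,
      key q hq p hp hqc hpc hx.symm hy.symm⟩).symm

/-! ### At most five points -/

lemma eq_cross {r : Setoid (Fin 4)} (h02 : r 0 2) (h13 : r 1 3) (h01 : ¬ r 0 1) : r = cross := by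
  have h : ∀ x y : Fin 4, r x y ↔ (![0, 1, 0, 1] : Fin 4 → ℕ) x = ![0, 1, 0, 1] y := by
    have h10 : ¬ r 1 0 := fun h => h01 (r.symm' h)
    have h03 : ¬ r 0 3 := fun h => h01 (r.trans' h (r.symm' h13))
    have h21 : ¬ r 2 1 := fun h => h01 (r.trans' h02 h)
    have h23 : ¬ r 2 3 := fun h => h03 (r.trans' h02 h)
    have h20 := r.symm' h02
    have h31 := r.symm' h13
    have h30 : ¬ r 3 0 := fun h => h03 (r.symm' h)
    have h12 : ¬ r 1 2 := fun h => h21 (r.symm' h)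
    have h32 : ¬ r 3 2 := fun h => h23 (r.symm' h)
    intro x y
    fin_cases x <;> fin_cases y <;> simp [*]
  ext x y
  rw [h, cross, Setoid.ker_def]

lemma cross_apply (x y : Fin 4) :
    cross x y ↔ (![0, 1, 0, 1] : Fin 4 → ℕ) x = ![0, 1, 0, 1] y := Setoid.ker_def

lemma eq_cross_of_not_planar {r : Setoid (Fin 4)} (hr : ¬ Planar Fin.val r) : r = cross := by
  obtain ⟨a, b, c, d, h⟩ := not_planar_iff.1 hr
  have h1 := h.lt₁
  have h2 := h.lt₂
  have h3 := h.lt₃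
  obtain rfl : a = 0 := by omega
  obtain rfl : b = 1 := by omega
  obtain rfl : c = 2 := by omega
  obtain rfl : d = 3 := by omega
  exact eq_cross h.rel₁ h.rel₂ h.not_rel

lemma not_planar_cross : ¬ Planar Fin.val cross :=
  not_planar_iff.2 ⟨0, 1, 2, 3, by decide, by decide, by decide, (cross_apply _ _).2 rfl,
    (cross_apply _ _).2 rfl, fun h => absurd ((cross_apply _ _).1 h) (by decide)⟩

lemma push_eq_cross_iff {X : Type*} {π : X → Fin 4} {r : Setoid X} :
    push π r = cross ↔ r ≤ cross.comap π ∧ (∃ u v, π u = 0 ∧ π v = 2 ∧ r u v) ∧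
      ∃ u v, π u = 1 ∧ π v = 3 ∧ r u v := by
  constructor
  · intro h
    have hle : r ≤ cross.comap π := push_le_iff.1 h.le
    have key : ∀ (a b : Fin 4) (f : Fin 4 → ℕ), f a ≠ f b → cross a b →
        (∀ i j, (![0, 1, 0, 1] : Fin 4 → ℕ) i = ![0, 1, 0, 1] j →
          f i = f j ∨ (i = a ∧ j = b) ∨ (i = b ∧ j = a)) →
        ∃ u v, π u = a ∧ π v = b ∧ r u v := by
      intro a b f hab hcr hf
      by_contra! hn
      have : push π r ≤ Setoid.ker f := by
        refine push_le_iff.2 fun u v huv => ?_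
        rcases hf _ _ ((cross_apply _ _).1 (hle huv)) with h | ⟨h, h'⟩ | ⟨h, h'⟩
        · exact h
        · exact absurd huv (hn u v h h')
        · exact absurd (r.symm' huv) (hn v u h' h)
      exact hab (this (h ▸ hcr))
    exact ⟨hle, key 0 2 ![0, 1, 2, 1] (by decide) ((cross_apply _ _).2 rfl) (by decide),
      key 1 3 ![0, 1, 0, 2] (by decide) ((cross_apply _ _).2 rfl) (by decide)⟩
  · rintro ⟨hle, ⟨u, v, hu, hv, huv⟩, ⟨u', v', hu', hv', huv'⟩⟩
    have h1 := le_comap_push π r huv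
    have h2 := le_comap_push π r huv'
    rw [Setoid.comap_rel, hu, hv] at h1
    rw [Setoid.comap_rel, hu', hv'] at h2
    exact eq_cross h1 h2 fun h =>
      absurd ((cross_apply _ _).1 (push_le_iff.2 hle h)) (by decide)

/-- The partition of five points with one block `{y, y + 2}` of size two and one of size three. -/
def pairLabel (y z : Fin 5) : Fin 2 := if z = y ∨ z = y + 2 then 0 else 1

/-- The crossing of four points with the additional singleton `x`. -/
def singleLabel (x : Fin 5) : Fin 5 → Fin 3 := x.insertNth 2 ![0, 1, 0, 1]

lemma comap_ker_eq_cross {Y : Type*} {f : Fin 5 → Y} {x : Fin 5}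
    (h : f (x.succAbove 0) = f (x.succAbove 2) ∧ f (x.succAbove 1) = f (x.succAbove 3) ∧
      f (x.succAbove 0) ≠ f (x.succAbove 1)) : (Setoid.ker f).comap x.succAbove = cross :=
  eq_cross h.1 h.2.1 h.2.2

lemma ker_eq_ker {X Y Z : Type*} {f : X → Y} {g : X → Z} (h : ∀ u v, f u = f v ↔ g u = g v) :
    Setoid.ker f = Setoid.ker g := Setoid.ext h

lemma comap_succAbove_eq_cross_iff {r : Setoid (Fin 5)} (x : Fin 5) :
    r.comap x.succAbove = cross ↔ r = Setoid.ker (singleLabel x) ∨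
      r = Setoid.ker (pairLabel (x + 1)) ∨ r = Setoid.ker (pairLabel (x + 2)) := by
  constructor
  · intro h
    have hs : ∀ i j, r (x.succAbove i) (x.succAbove j) ↔
        (![0, 1, 0, 1] : Fin 4 → Fin 3) i = ![0, 1, 0, 1] j := by
      intro i j
      rw [← Setoid.comap_rel, h, cross_apply]
      revert i j
      decide
    have key : ∀ c : Fin 3, (∀ j, r x (x.succAbove j) ↔ c = (![0, 1, 0, 1] : Fin 4 → Fin 3) j) →
        r = Setoid.ker (x.insertNth (α := fun _ => Fin 3) c ![0, 1, 0, 1]) := by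
      intro c hc
      ext u v
      rw [Setoid.ker_def]
      refine Fin.succAboveCases x ?_ (fun i => ?_) u <;>
        refine Fin.succAboveCases x ?_ (fun j => ?_) v <;>
        simp only [Fin.insertNth_apply_same, Fin.insertNth_apply_succAbove]
      · exact iff_of_true (r.refl' _) trivial
      · exact hc j
      · rw [r.comm', hc i, eq_comm]
      · exact hs i j
    have h02 := (hs 0 2).2 rfl
    have h13 := (hs 1 3).2 rfl
    have h01 : ¬ r (x.succAbove 0) (x.succAbove 1) := fun h => absurd ((hs 0 1).1 h) (by decide)
    have hP : ∀ x : Fin 5, (∀ u v, x.insertNth (α := fun _ => Fin 3) 0 ![0, 1, 0, 1] u =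
          x.insertNth (α := fun _ => Fin 3) 0 ![0, 1, 0, 1] v ↔
            pairLabel (x + 1) u = pairLabel (x + 1) v) ∨
        (∀ u v, x.insertNth (α := fun _ => Fin 3) 0 ![0, 1, 0, 1] u =
          x.insertNth (α := fun _ => Fin 3) 0 ![0, 1, 0, 1] v ↔
            pairLabel (x + 2) u = pairLabel (x + 2) v) := by decide
    have hP' : ∀ x : Fin 5, (∀ u v, x.insertNth (α := fun _ => Fin 3) 1 ![0, 1, 0, 1] u =
          x.insertNth (α := fun _ => Fin 3) 1 ![0, 1, 0, 1] v ↔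
            pairLabel (x + 1) u = pairLabel (x + 1) v) ∨
        (∀ u v, x.insertNth (α := fun _ => Fin 3) 1 ![0, 1, 0, 1] u =
          x.insertNth (α := fun _ => Fin 3) 1 ![0, 1, 0, 1] v ↔
            pairLabel (x + 2) u = pairLabel (x + 2) v) := by decide
    by_cases h0 : r x (x.succAbove 0)
    · rw [key 0 ?_]
      · exact Or.inr ((hP x).imp ker_eq_ker ker_eq_ker)
      · have h2 := r.trans' h0 h02
        have h1 : ¬ r x (x.succAbove 1) := fun h => h01 (r.trans' (r.symm' h0) h)
        have h3 : ¬ r x (x.succAbove 3) := fun h => h1 (r.trans' h (r.symm' h13))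
        intro j
        fin_cases j <;> simp [*]
    · have h2 : ¬ r x (x.succAbove 2) := fun h => h0 (r.trans' h (r.symm' h02))
      by_cases h1 : r x (x.succAbove 1)
      · rw [key 1 ?_]
        · exact Or.inr ((hP' x).imp ker_eq_ker ker_eq_ker)
        · have h3 := r.trans' h1 h13
          intro j
          fin_cases j <;> simp [*]
      · refine Or.inl (key 2 ?_)
        have h3 : ¬ r x (x.succAbove 3) := fun h => h1 (r.trans' h (r.symm' h13))
        intro j
        fin_cases j <;> simp [*] 
  · rintro (rfl | rfl | rfl)
    · exact comap_ker_eq_cross (by revert x; decide)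
    · exact comap_ker_eq_cross (by revert x; decide)
    · exact comap_ker_eq_cross (by revert x; decide)

lemma push_ker_eq_cross {Y : Type*} {π : Fin 5 → Fin 4} {f : Fin 5 → Y}
    (h : (∀ u v, f u = f v → (![0, 1, 0, 1] : Fin 4 → ℕ) (π u) = ![0, 1, 0, 1] (π v)) ∧
      (∃ u v, π u = 0 ∧ π v = 2 ∧ f u = f v) ∧ ∃ u v, π u = 1 ∧ π v = 3 ∧ f u = f v) :
    push π (Setoid.ker f) = cross :=
  push_eq_cross_iff.2 ⟨fun u v huv => (cross_apply _ _).2 (h.1 u v huv), h.2⟩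

lemma push_predAbove_eq_cross_iff {r : Setoid (Fin 5)} (m : Fin 4) :
    push m.predAbove r = cross ↔ r = Setoid.ker (singleLabel m.castSucc) ∨
      r = Setoid.ker (singleLabel m.succ) ∨ r = Setoid.ker (pairLabel (m.castSucc + 2)) := by
  constructor
  · intro h
    obtain ⟨hle, ⟨u, v, hu, hv, huv⟩, ⟨u', v', hu', hv', huv'⟩⟩ := push_eq_cross_iff.1 h
    have hfree : ∀ (m : Fin 4) (u v u' v' : Fin 5), m.predAbove u = 0 → m.predAbove v = 2 →
        m.predAbove u' = 1 → m.predAbove v' = 3 → ∃ x, (x = m.castSucc ∨ x = m.succ) ∧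
          x ≠ u ∧ x ≠ v ∧ x ≠ u' ∧ x ≠ v' := by decide
    obtain ⟨x, hx, h1, h2, h3, h4⟩ := hfree m u v u' v' hu hv hu' hv'
    have hsec : (∀ s, m.predAbove (x.succAbove s) = s) ∧
        ∀ u ≠ x, x.succAbove (m.predAbove u) = u := by
      rcases hx with rfl | rfl
      · clear * -
        revert m; decide
      · clear * -
        revert m; decide
    have hr : r.comap x.succAbove = cross := by
      refine eq_cross ?_ ?_ ?_
      · rwa [Setoid.comap_rel, ← hu, ← hv, hsec.2 u h1.symm, hsec.2 v h2.symm]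
      · rwa [Setoid.comap_rel, ← hu', ← hv', hsec.2 u' h3.symm, hsec.2 v' h4.symm]
      · intro h
        have h5 := hle h
        rw [Setoid.comap_rel, hsec.1, hsec.1, cross_apply] at h5
        exact absurd h5 (by decide)
    have hbad : ∀ y, r = Setoid.ker (pairLabel y) →
        (∃ u v, pairLabel y u = pairLabel y v ∧
          (![0, 1, 0, 1] : Fin 4 → ℕ) (m.predAbove u) ≠ ![0, 1, 0, 1] (m.predAbove v)) →
        False := by
      rintro y rfl ⟨u, v, huv, hne⟩
      exact hne ((cross_apply _ _).1 (hle huv))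
    rcases (comap_succAbove_eq_cross_iff x).1 hr with e | e | e <;> rcases hx with rfl | rfl
    · exact Or.inl e
    · exact Or.inr (Or.inl e)
    · exact (hbad _ e (by clear * -; revert m; decide)).elim
    · have : ∀ m : Fin 4, m.succ + 1 = m.castSucc + 2 := by decide
      exact Or.inr (Or.inr (this m ▸ e))
    · exact Or.inr (Or.inr e)
    · exact (hbad _ e (by clear * -; revert m; decide)).elim
  · rintro (rfl | rfl | rfl)
    · exact push_ker_eq_cross (by revert m; decide)
    · exact push_ker_eq_cross (by revert m; decide)
    · exact push_ker_eq_cross (by revert m; decide)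

lemma sum_ite_eq_of_iff {α : Type*} [Fintype α] {F : α → ℂ} {Q : α → Prop} {a b c : α}
    (hQ : ∀ r, Q r ↔ r = a ∨ r = b ∨ r = c) (hab : a ≠ b) (hac : a ≠ c) (hbc : b ≠ c) :
    ∑ r, (if Q r then F r else 0) = F a + F b + F c := by
  rw [← Finset.sum_filter]
  have : Finset.univ.filter Q = {a, b, c} := by
    ext r
    simp [hQ]
  rw [this, Finset.sum_insert (by simp [hab, hac]), Finset.sum_pair hbc, add_assoc]

lemma ker_ne_ker {X Y Z : Type*} {f : X → Y} {g : X → Z}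
    (h : ∃ u v, ¬ (f u = f v ↔ g u = g v)) : Setoid.ker f ≠ Setoid.ker g := by
  obtain ⟨u, v, h⟩ := h
  intro e
  exact h (Setoid.ext_iff.1 e u v)

lemma ker_pairLabel_injective : Function.Injective fun y => Setoid.ker (pairLabel y) := by
  intro y y' h
  by_contra hne
  have key : ∀ y y', y ≠ y' → ∃ u v, ¬ (pairLabel y u = pairLabel y v ↔
    pairLabel y' u = pairLabel y' v) := by decide
  exact ker_ne_ker (key y y' hne) h

lemma ker_singleLabel_ne_ker_pairLabel (x y : Fin 5) :
    Setoid.ker (singleLabel x) ≠ Setoid.ker (pairLabel y) :=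
  ker_ne_ker (by revert x y; decide)

/-- The linear system satisfied by the coefficients of the crossing partitions of five points. -/
lemma eq_zero_of_pentagon {N : ℕ} (hN : 4 ≤ N) {t p : Fin 5 → ℂ}
    (hE : ∀ x, t x + p (x + 1) + p (x + 2) = 0)
    (hF : ∀ m : Fin 4, t m.castSucc + t m.succ + N * p (m.castSucc + 2) = 0)
    (h0 : ∃ y, p y = 0) : (∀ y, p y = 0) ∧ ∀ x, t x = 0 := by
  obtain ⟨M, rfl⟩ := Nat.exists_eq_add_of_le' hN
  push_cast at hF
  have hE0 : t 0 + p 1 + p 2 = 0 := hE 0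
  have hE1 : t 1 + p 2 + p 3 = 0 := hE 1
  have hE2 : t 2 + p 3 + p 4 = 0 := hE 2
  have hE3 : t 3 + p 4 + p 0 = 0 := hE 3
  have hE4 : t 4 + p 0 + p 1 = 0 := hE 4
  have hF0 : t 0 + t 1 + (M + 4) * p 2 = 0 := hF 0
  have hF1 : t 1 + t 2 + (M + 4) * p 3 = 0 := hF 1
  have hF2 : t 2 + t 3 + (M + 4) * p 4 = 0 := hF 2
  have hF3 : t 3 + t 4 + (M + 4) * p 0 = 0 := hF 3
  have n1 : (M : ℂ) + 1 ≠ 0 := by exact_mod_cast Nat.succ_ne_zero M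
  have n2 : (M : ℂ) ^ 2 + 3 * M + 1 ≠ 0 := by exact_mod_cast Nat.succ_ne_zero (M ^ 2 + 3 * M)
  have n3 : (M : ℂ) ^ 2 + 5 * M + 5 ≠ 0 := by exact_mod_cast Nat.succ_ne_zero (M ^ 2 + 5 * M + 4)
  have s1 : p 2 = p 0 := by
    have : ((M : ℂ) ^ 2 + 5 * M + 5) * (p 2 - p 0) = 0 := by
      linear_combination (M + 3) * (hF0 - hE0 - hE1 - hF3 + hE3 + hE4) +
        (hF1 - hE1 - hE2 - hF2 + hE2 + hE3)
    exact sub_eq_zero.1 ((mul_eq_zero.1 this).resolve_left n3)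
  have s2 : p 3 = p 4 := by
    linear_combination -(hF0 - hE0 - hE1 - hF3 + hE3 + hE4) + (M + 2) * s1
  have s3 : p 2 = (M + 1) * p 3 := by
    linear_combination -(hF1 - hE1 - hE2) + s2
  have s4 : p 1 = (M ^ 2 + 3 * M + 1) * p 3 := by
    linear_combination -(hF0 - hE0 - hE1) + (M + 2) * s3
  have hz : p 3 = 0 := by
    obtain ⟨y, hy⟩ := h0
    fin_cases y
    · exact (mul_eq_zero.1 (s3.symm.trans (s1.trans hy))).resolve_left n1
    · exact (mul_eq_zero.1 (s4.symm.trans hy)).resolve_left n2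
    · exact (mul_eq_zero.1 (s3.symm.trans hy)).resolve_left n1
    · exact hy
    · exact s2.trans hy
  have hp : ∀ y, p y = 0 := by
    intro y
    fin_cases y
    · exact s1.symm.trans (s3.trans (by rw [hz, mul_zero]))
    · exact s4.trans (by rw [hz, mul_zero])
    · exact s3.trans (by rw [hz, mul_zero])
    · exact hz
    · exact s2.symm.trans hz
  exact ⟨hp, fun x => by simpa [hp] using hE x⟩

lemma rigid_of_lt {N n : ℕ} (C : TKDual N) (hn : n < 4) : Rigid C n := by
  intro g hpl _ _ r
  by_contra hr
  obtain ⟨a, b, c, d, h⟩ := not_planar_iff.1 fun h => hr (hpl r h)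
  have h1 := h.lt₁
  have h2 := h.lt₂
  have h3 := h.lt₃
  have := d.isLt
  omega

lemma rigid_four {N : ℕ} (hN : 0 < N) {C : TKDual N} (hX : ind cross ∉ vectors C 4) :
    Rigid C 4 := by
  intro g hpl _ hg r
  by_contra hr
  obtain rfl := eq_cross_of_not_planar fun h => hr (hpl r h)
  rw [Finset.sum_eq_single cross ?_ (by simp)] at hg
  · rw [unitVec, smul_smul] at hg
    exact hX ((Submodule.smul_mem_iff _
      (mul_ne_zero hr (inv_ne_zero (tot_ne_zero hN cross)))).1 hg)
  · intro s _ hs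
    rw [hpl s (by_contra fun h => hs (eq_cross_of_not_planar h)), zero_smul]

lemma rigid_five {N : ℕ} (hN : 4 ≤ N) {C : TKDual N} (hC : ∀ a b, NCfam N a b ≤ C.C a b)
    (hR : Rigid C 4) : Rigid C 5 := by
  intro g hpl hcard hg
  have hN0 : 0 < N := by omega
  have hNC : (N : ℂ) ≠ 0 := by exact_mod_cast hN0.ne'
  have hE : ∀ x, g (Setoid.ker (singleLabel x)) + g (Setoid.ker (pairLabel (x + 1))) +
      g (Setoid.ker (pairLabel (x + 2))) = 0 := by
    intro x
    have he := Fin.strictMono_succAbove x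
    have := sum_fiber_eq_zero hC hR (restrictMat_mem hC he)
      (φ := fun r => r.comap x.succAbove) (c := fun _ => 1)
      (fun r => by rw [restrictMat_unitVec hN0 he, one_smul]) hcard hg not_planar_cross
    rw [sum_ite_eq_of_iff (fun r => comap_succAbove_eq_cross_iff x)
      (ker_singleLabel_ne_ker_pairLabel _ _) (ker_singleLabel_ne_ker_pairLabel _ _)
      (ker_pairLabel_injective.ne (by clear * -; revert x; decide))] at this
    simpa only [one_mul] using this
  have hF : ∀ m : Fin 4, g (Setoid.ker (singleLabel m.castSucc)) +
      g (Setoid.ker (singleLabel m.succ)) +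
      N * g (Setoid.ker (pairLabel (m.castSucc + 2))) = 0 := by
    intro m
    have := sum_fiber_eq_zero hC hR (mergeMat_mem hC (Fin.predAbove_right_monotone m))
      (mergeMat_unitVec hN0 m.predAbove) hcard hg not_planar_cross
    rw [sum_ite_eq_of_iff (fun r => push_predAbove_eq_cross_iff m)
      (ker_ne_ker (by clear * -; revert m; decide)) (ker_singleLabel_ne_ker_pairLabel _ _)
      (ker_singleLabel_ne_ker_pairLabel _ _),
      (push_predAbove_eq_cross_iff m).2 (Or.inl rfl),
      (push_predAbove_eq_cross_iff m).2 (Or.inr (Or.inl rfl)),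
      (push_predAbove_eq_cross_iff m).2 (Or.inr (Or.inr rfl)),
      tot_ker (by clear * -; revert m; decide), tot_ker (by clear * -; revert m; decide),
      tot_ker (by clear * -; revert m; decide)] at this
    have ht := tot_ne_zero hN0 cross
    field_simp at this
    rw [mul_zero] at this
    exact (mul_eq_zero.1 this).resolve_left ht
  have h0 : ∃ y, g (Setoid.ker (pairLabel y)) = 0 := by
    by_contra! hn
    have : (Finset.univ.image fun y => Setoid.ker (pairLabel y)).card ≤ 3 :=
      le_trans (Finset.card_le_card fun r hr => by
        obtain ⟨y, -, rfl⟩ := Finset.mem_image.1 hr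
        exact Finset.mem_filter.2 ⟨Finset.mem_univ _, hn y⟩) hcard
    rw [Finset.card_image_of_injective _ ker_pairLabel_injective] at this
    simp at this
  obtain ⟨hp, ht⟩ := eq_zero_of_pentagon hN (t := fun x => g (Setoid.ker (singleLabel x)))
    (p := fun y => g (Setoid.ker (pairLabel y))) hE hF h0
  intro r
  by_cases hr : Planar Fin.val r
  · exact hpl r hr
  · obtain ⟨a, b, c, d, hrc⟩ := not_planar_iff.1 hr
    obtain ⟨x, hx⟩ : ∃ x : Fin 5, x ≠ a ∧ x ≠ b ∧ x ≠ c ∧ x ≠ d := by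
      have h : 0 < (({a, b, c, d} : Finset (Fin 5))ᶜ).card := by
        rw [Finset.card_compl, Fintype.card_fin]
        have := Finset.card_le_four (a := a) (b := b) (c := c) (d := d)
        omega
      obtain ⟨x, hx⟩ := Finset.card_pos.1 h
      exact ⟨x, by simpa using hx⟩
    rcases (comap_succAbove_eq_cross_iff x).1
      (eq_cross_of_not_planar (hrc.not_planar_comap hx)) with rfl | rfl | rfl
    · exact ht x
    · exact hp (x + 1)
    · exact hp (x + 2)

lemma rigid {N : ℕ} (hN : 4 ≤ N) {C : TKDual N} (hC : ∀ a b, NCfam N a b ≤ C.C a b)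
    (hX : ind cross ∉ vectors C 4) (n : ℕ) : Rigid C n := by
  have hN0 : 0 < N := by omega
  induction n with
  | zero => exact rigid_of_lt C (by omega)
  | succ n ih =>
    rcases lt_or_ge n 5 with hn | hn
    · interval_cases n
      · exact rigid_of_lt C (by omega)
      · exact rigid_of_lt C (by omega)
      · exact rigid_of_lt C (by omega)
      · exact rigid_four hN0 hX
      · exact rigid_five hN hC ih
    · intro g hpl hcard hg r
      have := (paired_support hN0 hC ih hpl hcard hg).eq_empty hn hcard
      by_contra hr
      have hmem : r ∈ Finset.univ.filter fun r => g r ≠ 0 :=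
        Finset.mem_filter.2 ⟨Finset.mem_univ r, hr⟩
      rw [this] at hmem
      exact Finset.notMem_empty r hmem

lemma eq_sum_unitVec {N k : ℕ} (hN : 0 < N) {ι : Type*} (I : Finset ι)
    (r : ι → Setoid (Fin k)) (α : ι → ℂ) :
    ∑ i ∈ I, α i • (ind (r i) : (Fin k → Fin N) → ℂ) =
      ∑ s, (∑ i ∈ I, if r i = s then α i * tot N s else 0) • unitVec N s := by
  simp only [Finset.sum_smul, ite_smul, zero_smul]
  rw [Finset.sum_comm]
  refine Finset.sum_congr rfl fun i _ => ?_
  rw [Finset.sum_ite_eq, if_pos (Finset.mem_univ _), unitVec, smul_smul, mul_assoc,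
    mul_inv_cancel₀ (tot_ne_zero hN _), mul_one]

lemma NCfam_le_genNCxi {N k : ℕ} (ξ : (Fin k → Fin N) → ℂ) (k' ℓ' : ℕ) :
    NCfam N k' ℓ' ≤ genNCxi N ξ k' ℓ' :=
  le_iInf fun _ => le_iInf fun hC => le_iInf fun _ => hC k' ℓ'

lemma genNCxi_le {N k : ℕ} {ξ : (Fin k → Fin N) → ℂ} {C : TKDual N}
    (hC : ∀ a b, NCfam N a b ≤ C.C a b) (hξ : ξ ∈ vectors C k) (k' ℓ' : ℕ) :
    genNCxi N ξ k' ℓ' ≤ C.C k' ℓ' :=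
  iInf_le_of_le C (iInf_le_of_le hC (iInf_le _ hξ))

lemma NCfam_le_Pfam (N k ℓ : ℕ) : NCfam N k ℓ ≤ Pfam N k ℓ :=
  Submodule.span_mono fun _ ⟨p, _, hp⟩ => ⟨p, hp.symm⟩

/-- Maximality for a combination of at most three partition vectors. -/
theorem genNCxi_eq_or_eq {N k : ℕ} (hN : 4 ≤ N) {ι : Type*} {I : Finset ι} (hI : I.card ≤ 3)
    (r : ι → Setoid (Fin k)) (α : ι → ℂ) {ξ : (Fin k → Fin N) → ℂ}
    (hξ : ξ = ∑ i ∈ I, α i • ind (r i)) :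
    (∀ k' ℓ', genNCxi N ξ k' ℓ' = NCfam N k' ℓ') ∨
    (∀ k' ℓ', genNCxi N ξ k' ℓ' = Pfam N k' ℓ') := by
  have hsum := hξ.trans (eq_sum_unitVec (by omega) I r α)
  set G : Setoid (Fin k) → ℂ := fun s => ∑ i ∈ I, if r i = s then α i * tot N s else 0
  by_cases hpl : ∀ s, ¬ Planar Fin.val s → G s = 0
  · refine Or.inl fun k' ℓ' => le_antisymm ?_ (NCfam_le_genNCxi ξ k' ℓ')
    have hC : ∀ a b, NCfam N a b ≤ (famDual True N).C a b := fun a b => (NCfam_eq_fam N a b).le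
    refine (genNCxi_le hC ?_ k' ℓ').trans (NCfam_eq_fam N k' ℓ').ge
    rw [hsum]
    refine Submodule.sum_mem _ fun s _ => ?_
    by_cases hs : Planar Fin.val s
    · exact Submodule.smul_mem _ _ (unitVec_mem_vectors hC hs)
    · change G s • _ ∈ _
      rw [hpl s hs, zero_smul]
      exact Submodule.zero_mem _
  · refine Or.inr fun k' ℓ' => le_antisymm ?_ ?_
    · have hC : ∀ a b, NCfam N a b ≤ (famDual False N).C a b := fun a b =>
        (NCfam_le_Pfam N a b).trans (Pfam_eq_fam N a b).le
      refine (genNCxi_le hC ?_ k' ℓ').trans (Pfam_eq_fam N k' ℓ').ge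
      rw [hξ]
      exact Submodule.sum_mem _ fun i _ =>
        Submodule.smul_mem _ _ (vecMat_ind_mem_fam (planar := False) False.elim)
    · refine le_iInf fun C => le_iInf fun hC => le_iInf fun hmem => ?_
      refine Pfam_le_of_cross hC ?_ k' ℓ'
      by_contra hX
      refine hpl fun s hs => (rigid hN hC hX k).eq_zero hC ?_ (hsum ▸ hmem) hs
      refine le_trans (le_trans (Finset.card_le_card fun t ht => ?_)
        (Finset.card_image_le (s := I) (f := r))) hI
      obtain ⟨i, hi, h⟩ := Finset.exists_ne_zero_of_sum_ne_zero (Finset.mem_filter.1 ht).2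
      rw [ite_ne_right_iff] at h
      exact Finset.mem_image.2 ⟨i, hi, h.1⟩

end NCMax

/-- maximality at easiness level three: for `N ≥ 4`, distinct
partitions `p₁, p₂, p₃` of `[k]`, `α₁, α₂, α₃ ∈ ℂ`, and nonzero
`ξ = α₁ ξ_{p₁} + α₂ ξ_{p₂} + α₃ ξ_{p₃}`, the Tannaka–Krein dual `⟨NC, ξ⟩`
equals `NC` or equals `P`. -/
theorem stmt19 {N k : ℕ} (hN : 4 ≤ N)
    (p₁ p₂ p₃ : Finpartition (Finset.univ : Finset (Fin k)))
    (h12 : p₁ ≠ p₂) (h13 : p₁ ≠ p₃) (h23 : p₂ ≠ p₃)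
    (α₁ α₂ α₃ : ℂ) (ξ : (Fin k → Fin N) → ℂ)
    (hξ : ξ = α₁ • xi N p₁ + α₂ • xi N p₂ + α₃ • xi N p₃) (hne : ξ ≠ 0) :
    (∀ k' ℓ', genNCxi N ξ k' ℓ' = NCfam N k' ℓ') ∨
    (∀ k' ℓ', genNCxi N ξ k' ℓ' = Pfam N k' ℓ') := by
  refine NCMax.genNCxi_eq_or_eq hN (I := Finset.univ) (by simp)
    (fun i => NCMax.toSetoid (![p₁, p₂, p₃] i)) ![α₁, α₂, α₃] ?_
  rw [hξ, Fin.sum_univ_three]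
  simp only [NCMax.xi_eq_ind]
  rfl
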